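/- arXiv:1910.01374 — 7 statements merged into one kernel-verified Lean document; each statement's English description precedes it below -/
import Mathlib

section
/- Let M = (m_{i,j}) be a real n×n matrix, let 0 ≤ h ≤ n−2, and let {c_1,...,c_h,a,b} and {γ_1,...,γ_h,α,β} be subsets of {1,...,n} (of sizes h+2 each, with all listed elements distinct). Suppose the rows R_α and R_β of M have the (A_1,...,A_t)-property for some partition (A_1,...,A_t) of {1,...,n}, and a ∈ A_k, b ∈ A_m for some k ≠ m. Then g_M(S_{c_1,...,c_h,a,b}^{γ_1,...,γ_h,α,β} ∪ S_{c_1,...,c_h,b,a}^{γ_1,...,γ_h,α,β}) ≥ (n−h−2)!. -/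
open Finset

open scoped Classical in
/-- g_M(X): the number of permutations π in X whose associated diagonal sum
∑ i, m_{i,π(i)} is nonzero. -/
noncomputable def gM (n : ℕ) (M : Matrix (Fin n) (Fin n) ℝ)
    (X : Finset (Equiv.Perm (Fin n))) : ℕ :=
  (X.filter (fun π => ∑ i, M i (π i) ≠ 0)).card

/-- g_M(n): the number of permutations π in Sym_n with ∑ i, m_{i,π(i)} ≠ 0. -/
noncomputable def gMn (n : ℕ) (M : Matrix (Fin n) (Fin n) ℝ) : ℕ :=
  gM n M Finset.univ

/-- (A_1,...,A_t) is a partition of {1,...,n}: the parts are nonempty, pairwise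
disjoint, and cover everything. -/
def IsPartition (n t : ℕ) (A : Fin t → Finset (Fin n)) : Prop :=
  (∀ k, (A k).Nonempty) ∧ (∀ k m, k ≠ m → Disjoint (A k) (A m)) ∧
    (Finset.univ.biUnion A = Finset.univ)

/-- The rows R_α, R_β of M have the (A_1,...,A_t)-property:
for all k ≠ m, a ∈ A_k, b ∈ A_m we have m_{α,a} + m_{β,b} ≠ m_{α,b} + m_{β,a}. -/
def RowsProperty (n t : ℕ) (M : Matrix (Fin n) (Fin n) ℝ)
    (A : Fin t → Finset (Fin n)) (α β : Fin n) : Prop :=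
  ∀ k m : Fin t, k ≠ m → ∀ a ∈ A k, ∀ b ∈ A m, M α a + M β b ≠ M α b + M β a

open scoped Classical in
/-- S_{a_1,...,a_ℓ}^{γ_1,...,γ_ℓ}: the set of permutations π with π(γ_i) = a_i for
all i. -/
noncomputable def SFix {n ℓ : ℕ} (a γ : Fin ℓ → Fin n) : Finset (Equiv.Perm (Fin n)) :=
  Finset.univ.filter (fun π => ∀ i, π (γ i) = a i)

open scoped Classical in
/-- There are at least `(n - ℓ)!` permutations with `ℓ` prescribed values. -/
theorem factorial_le_card_SFix {n ℓ : ℕ} {a γ : Fin ℓ → Fin n}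
    (ha : Function.Injective a) (hγ : Function.Injective γ) :
    (n - ℓ).factorial ≤ (SFix a γ).card := by
  have := Equiv.Perm.isMultiplyPretransitive (Fin n) ℓ
  obtain ⟨σ, hσ⟩ := MulAction.exists_smul_eq (Equiv.Perm (Fin n))
    (⟨γ, hγ⟩ : Fin ℓ ↪ Fin n) ⟨a, ha⟩
  have hσ' (i : Fin ℓ) : σ (γ i) = a i := DFunLike.congr_fun hσ i
  have hcard : Fintype.card {x // x ∉ Set.range γ} = n - ℓ := by
    have h := Fintype.card_subtype_compl (fun x => x ∈ Set.range γ)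
    have h' : Fintype.card {x // x ∈ Set.range γ} = ℓ := by
      rw [← Fintype.card_congr (Equiv.ofInjective γ hγ), Fintype.card_fin]
    rw [h', Fintype.card_fin] at h
    exact h
  rw [← hcard, ← Fintype.card_perm, ← Finset.card_univ]
  refine Finset.card_le_card_of_injOn (fun τ => σ * Equiv.Perm.ofSubtype τ) ?_ ?_
  · intro τ _
    simp only [SFix, Finset.coe_filter, Finset.mem_univ, true_and, Set.mem_ofPred_eq,
      Equiv.Perm.mul_apply]
    intro i
    rw [Equiv.Perm.ofSubtype_apply_of_not_mem τ (by simp), hσ']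
  · intro τ _ τ' _ h
    exact Equiv.Perm.ofSubtype_injective (mul_left_cancel h)

theorem mem_SFix_snoc_snoc {n h : ℕ} {c γ : Fin h → Fin n} {a b α β : Fin n}
    {π : Equiv.Perm (Fin n)} :
    π ∈ SFix (Fin.snoc (Fin.snoc c a) b : Fin (h + 2) → Fin n)
        (Fin.snoc (Fin.snoc γ α) β : Fin (h + 2) → Fin n) ↔
      (∀ i, π (γ i) = c i) ∧ π α = a ∧ π β = b := by
  simp [SFix, Fin.forall_fin_succ', and_assoc]

theorem sum_sub_sum_mul_swap {n : ℕ} (M : Matrix (Fin n) (Fin n) ℝ) (π : Equiv.Perm (Fin n))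
    {α β : Fin n} (hαβ : α ≠ β) :
    ∑ i, M i (π i) - ∑ i, M i ((π * Equiv.swap α β) i) =
      (M α (π α) + M β (π β)) - (M α (π β) + M β (π α)) := by
  rw [← Finset.sum_sub_distrib, Fintype.sum_eq_add α β hαβ]
  · simp
    ring
  · rintro i ⟨hiα, hiβ⟩
    simp [Equiv.swap_apply_of_ne_of_ne hiα hiβ]

/-- Lemma 1: with rows R_α, R_β having the (A_1,...,A_t)-property,
a ∈ A_k, b ∈ A_m (k ≠ m), and distinct positions/values c_1,...,c_h,a,b and
γ_1,...,γ_h,α,β, one has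
g_M(S_{c_1,...,c_h,a,b}^{γ_1,...,γ_h,α,β} ∪ S_{c_1,...,c_h,b,a}^{γ_1,...,γ_h,α,β})
≥ (n−h−2)!. -/
theorem statement4 (n t h : ℕ) (M : Matrix (Fin n) (Fin n) ℝ)
    (ht : 2 ≤ t) (hh : h + 2 ≤ n)
    (A : Fin t → Finset (Fin n)) (hA : IsPartition n t A)
    (α β : Fin n) (hαβ : α ≠ β)
    (hprop : RowsProperty n t M A α β)
    (k m : Fin t) (hkm : k ≠ m) (a b : Fin n) (ha : a ∈ A k) (hb : b ∈ A m)
    (c γ : Fin h → Fin n)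
    (hinj1 : Function.Injective (Fin.snoc (Fin.snoc c a) b : Fin (h + 2) → Fin n))
    (hinj2 : Function.Injective (Fin.snoc (Fin.snoc γ α) β : Fin (h + 2) → Fin n)) :
    Nat.factorial (n - h - 2) ≤
      gM n M
        (SFix (Fin.snoc (Fin.snoc c a) b) (Fin.snoc (Fin.snoc γ α) β) ∪
          SFix (Fin.snoc (Fin.snoc c b) a) (Fin.snoc (Fin.snoc γ α) β)) := by
  classical
  have hne_c {i : Fin h} : γ i ≠ α ∧ γ i ≠ β := by
    constructor <;> intro hi
    · have := @hinj2 i.castSucc.castSucc (Fin.last h).castSucc (by simpa using hi)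
      simp [Fin.ext_iff] at this
      omega
    · have := @hinj2 i.castSucc.castSucc (Fin.last (h + 1)) (by simpa using hi)
      simp [Fin.ext_iff] at this
      omega
  have hab : a ≠ b := fun hab => Finset.disjoint_left.mp (hA.2.1 k m hkm) ha (hab ▸ hb)
  rw [Nat.sub_sub]
  refine (factorial_le_card_SFix hinj1 hinj2).trans ?_
  refine Finset.card_le_card_of_injOn
    (fun π => if ∑ i, M i (π i) ≠ 0 then π else π * Equiv.swap α β) ?_ ?_
  · intro π hπ
    obtain ⟨hc, hα, hβ⟩ := mem_SFix_snoc_snoc.mp hπ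
    simp only [Finset.coe_filter, Set.mem_ofPred_eq, Finset.mem_union, mem_SFix_snoc_snoc]
    split_ifs with hs
    · exact ⟨Or.inl ⟨hc, hα, hβ⟩, hs⟩
    · refine ⟨Or.inr ⟨fun i => ?_, by simpa, by simpa⟩, fun hs' => ?_⟩
      · rw [Equiv.Perm.mul_apply, Equiv.swap_apply_of_ne_of_ne hne_c.1 hne_c.2, hc]
      · have hsub := sum_sub_sum_mul_swap M π hαβ
        rw [not_not.mp hs, hs', hα, hβ] at hsub
        exact hprop k m hkm a ha b hb (by linarith)
  · intro π hπ π' hπ' h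
    obtain ⟨-, hα, hβ⟩ := mem_SFix_snoc_snoc.mp hπ
    obtain ⟨-, hα', hβ'⟩ := mem_SFix_snoc_snoc.mp hπ'
    have hval := DFunLike.congr_fun h α
    dsimp only at h hval
    split_ifs at h hval
    · exact h
    · simp [hα, hβ', hab] at hval
    · simp [hβ, hα', hab.symm] at hval
    · exact mul_right_cancel h
end

section
/- Let M be a real n×n matrix and let α, β ∈ {1,...,n} with α ≠ β. Suppose the rows R_α and R_β of M have the (A_1,...,A_t)-property for a partition (A_1,...,A_t) of {1,...,n}. Then g_M(n) ≥ (∑_{1 ≤ k < m ≤ t} |A_k|·|A_m|)·(n−2)!. -/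
open Finset

/-- For `α ≠ β` and `a ≠ b`, at least `(n - 2)!` permutations send `α` to `a` and `β` to `b`. -/
theorem factorial_le_card_perm_two_values {n : ℕ} {α β a b : Fin n} (hαβ : α ≠ β) (hab : a ≠ b) :
    Nat.factorial (n - 2) ≤
      #{π : Equiv.Perm (Fin n) | π α = a ∧ π β = b} := by
  classical
  obtain ⟨σ, hσα, hσβ⟩ : ∃ σ : Equiv.Perm (Fin n), σ α = a ∧ σ β = b := by
    refine ⟨Equiv.swap (Equiv.swap α a β) b * Equiv.swap α a, ?_, ?_⟩
    · have h : a ≠ Equiv.swap α a β := fun h => hαβ <| by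
        simpa using congrArg (Equiv.swap α a) h
      simp [Equiv.swap_apply_of_ne_of_ne h hab]
    · simp
  have hcard : Fintype.card {x : Fin n // x ∉ ({α, β} : Finset (Fin n))} = n - 2 := by
    rw [Fintype.card_subtype_compl]
    rw [Fintype.card_coe, Finset.card_pair hαβ, Fintype.card_fin]
  rw [← hcard, ← Fintype.card_perm, ← Finset.card_univ]
  refine Finset.card_le_card_of_injOn (fun τ => σ * Equiv.Perm.ofSubtype τ) ?_ ?_
  · intro τ _
    simp [Equiv.Perm.ofSubtype_apply_of_not_mem, hσα, hσβ]
  · intro τ _ τ' _ h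
    exact Equiv.Perm.ofSubtype_injective (mul_left_cancel h)

/-- The number of pairs `(a, b)` with `a ∈ A k` and `b ∈ A m` for some `k < m`. -/
theorem card_pairs_of_pairwise_disjoint {ι κ : Type*} [Fintype ι] [LinearOrder ι] [DecidableEq κ]
    (A : ι → Finset κ) (hA : ∀ k m, k ≠ m → Disjoint (A k) (A m)) :
    #((univ.filter fun p : ι × ι => p.1 < p.2).biUnion fun p => A p.1 ×ˢ A p.2) =
      ∑ p ∈ univ.filter (fun p : ι × ι => p.1 < p.2), #(A p.1) * #(A p.2) := by
  rw [Finset.card_biUnion]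
  · simp only [Finset.card_product]
  · rintro ⟨k, m⟩ _ ⟨k', m'⟩ _ hne
    rw [Function.onFun, Finset.disjoint_product]
    by_cases h : k = k'
    · exact Or.inr (hA _ _ fun h' => hne (Prod.ext h h'))
    · exact Or.inl (hA _ _ h)

/-- If a permutation and its composition with `swap α β` both have diagonal sum zero, then
the two rows do not separate the values `π α` and `π β`. -/
theorem add_eq_add_of_diagonal_sum_eq_zero {n : ℕ} {M : Matrix (Fin n) (Fin n) ℝ} {α β : Fin n}
    (hαβ : α ≠ β) {π : Equiv.Perm (Fin n)} (h : ∑ i, M i (π i) = 0)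
    (h' : ∑ i, M i ((π * Equiv.swap α β) i) = 0) :
    M α (π α) + M β (π β) = M α (π β) + M β (π α) := by
  have key : ∑ i, (M i (π i) - M i ((π * Equiv.swap α β) i)) = 0 := by
    rw [Finset.sum_sub_distrib, h, h', sub_zero]
  rw [Fintype.sum_eq_add α β hαβ] at key
  · simp only [Equiv.Perm.mul_apply, Equiv.swap_apply_left, Equiv.swap_apply_right] at key
    linarith
  · rintro x ⟨hα, hβ⟩
    simp [Equiv.swap_apply_of_ne_of_ne hα hβ]

/-- Lemma 2: if the rows R_α, R_β of M have the (A_1,...,A_t)-property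
for a partition (A_1,...,A_t) of {1,...,n}, then
g_M(n) ≥ (∑_{k < m} |A_k|·|A_m|) · (n−2)!. -/
theorem statement5 (n t : ℕ) (M : Matrix (Fin n) (Fin n) ℝ) (ht : 2 ≤ t)
    (A : Fin t → Finset (Fin n)) (hA : IsPartition n t A)
    (α β : Fin n) (hαβ : α ≠ β) (hprop : RowsProperty n t M A α β) :
    (∑ p ∈ Finset.univ.filter (fun p : Fin t × Fin t => p.1 < p.2),
        (A p.1).card * (A p.2).card) * Nat.factorial (n - 2) ≤ gMn n M := by
  classical
  obtain ⟨-, hdisj, -⟩ := hA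
  rw [← card_pairs_of_pairwise_disjoint A hdisj]
  set P := (univ.filter fun p : Fin t × Fin t => p.1 < p.2).biUnion
    fun p => A p.1 ×ˢ A p.2 with hP
  have mem_P (a b : Fin n) : (a, b) ∈ P ↔ ∃ k m, k < m ∧ a ∈ A k ∧ b ∈ A m := by
    simp [hP]
  have index_eq {x : Fin n} {k m : Fin t} (hk : x ∈ A k) (hm : x ∈ A m) : k = m := by
    by_contra h
    exact Finset.disjoint_left.mp (hdisj k m h) hk hm
  have asymm_P {a b : Fin n} (h : (a, b) ∈ P) (h' : (b, a) ∈ P) : False := by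
    obtain ⟨k, m, hkm, ha, hb⟩ := (mem_P a b).mp h
    obtain ⟨k', m', hkm', hb', ha'⟩ := (mem_P b a).mp h'
    rw [index_eq ha ha', index_eq hb hb'] at hkm
    exact lt_asymm hkm hkm'
  set B : Finset (Equiv.Perm (Fin n)) := univ.filter fun π => (π α, π β) ∈ P with hB
  have card_B : #P * Nat.factorial (n - 2) ≤ #B := by
    rw [Finset.card_eq_sum_card_fiberwise (f := fun π : Equiv.Perm (Fin n) => (π α, π β))
      (s := B) (t := P) (fun π hπ => by simpa [hB] using hπ), ← smul_eq_mul]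
    refine Finset.card_nsmul_le_sum _ _ _ ?_
    rintro ⟨a, b⟩ hab
    have hne : a ≠ b := by
      rintro rfl
      exact asymm_P hab hab
    refine (factorial_le_card_perm_two_values hαβ hne).trans (Finset.card_le_card ?_)
    intro π hπ
    obtain ⟨rfl, rfl⟩ : π α = a ∧ π β = b := by simpa using hπ
    simpa [hB] using hab
  refine card_B.trans ?_
  unfold gMn gM
  have swap_notMem {π σ : Equiv.Perm (Fin n)} (hπ : π ∈ B) (hσ : σ ∈ B)
      (h : π = σ * Equiv.swap α β) : False := by
    subst h
    simp only [hB, Finset.mem_filter, Finset.mem_univ, true_and, Equiv.Perm.mul_apply,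
      Equiv.swap_apply_left, Equiv.swap_apply_right] at hπ hσ
    exact asymm_P hπ hσ
  refine Finset.card_le_card_of_injOn
    (fun π => if ∑ i, M i (π i) ≠ 0 then π else π * Equiv.swap α β) ?_ ?_
  · intro π hπ
    simp only [Finset.coe_filter, Finset.mem_univ, true_and, Set.mem_ofPred_eq]
    split_ifs with h
    · exact h
    · intro h'
      obtain ⟨k, m, hkm, ha, hb⟩ := (mem_P _ _).mp (Finset.mem_filter.mp hπ).2
      exact hprop k m hkm.ne _ ha _ hb
        (add_eq_add_of_diagonal_sum_eq_zero hαβ (not_not.mp h) h')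
  · intro π hπ σ hσ h
    dsimp only at h
    split_ifs at h
    · exact h
    · exact (swap_notMem hπ hσ h).elim
    · exact (swap_notMem hσ hπ h.symm).elim
    · exact mul_right_cancel h
end

section
/- Let n ≥ 7 and t ≥ 3 be integers, and let n = n_1 + ... + n_t where each n_i is a positive integer and n_1 ≥ n_2 ≥ ... ≥ n_t. Then either ∑_{1 ≤ k < m ≤ t} n_k·n_m > 2(n−1), or t = 3, n_1 = n−2 and n_2 = n_3 = 1. -/
open Finset

theorem sum_sq_eq_sum_sq_add_two_mul_sum_lt {ι : Type*} [Fintype ι] [LinearOrder ι]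
    (a : ι → ℕ) :
    (∑ i, a i) ^ 2 = ∑ i, a i ^ 2 +
      2 * ∑ p ∈ Finset.univ.filter (fun p : ι × ι => p.1 < p.2), a p.1 * a p.2 := by
  have hswap : ∑ p : ι × ι, (if p.2 < p.1 then a p.1 * a p.2 else 0) =
      ∑ p : ι × ι, (if p.1 < p.2 then a p.1 * a p.2 else 0) :=
    Fintype.sum_equiv (Equiv.prodComm ι ι) _ _ fun p => by simp [mul_comm]
  have hdiag : ∑ p : ι × ι, (if p.1 = p.2 then a p.1 * a p.2 else 0) = ∑ i, a i ^ 2 := by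
    simp [Fintype.sum_prod_type, sq]
  rw [sq, Fintype.sum_mul_sum, ← Fintype.sum_prod_type', Finset.sum_filter, two_mul, ← hdiag]
  nth_rewrite 2 [← hswap]
  rw [← Finset.sum_add_distrib, ← Finset.sum_add_distrib]
  refine Finset.sum_congr rfl fun p _ => ?_
  rcases lt_trichotomy p.1 p.2 with h | h | h
  · simp [h, h.ne, h.not_gt]
  · simp [h]
  · simp [h, h.ne', h.not_gt]

/-- Lemma 3: let n = n_1 + ... + n_t with n ≥ 7, t ≥ 3, all n_i positive
integers and n_1 ≥ n_2 ≥ ... ≥ n_t. Then either ∑_{k<m} n_k n_m > 2(n−1), or t = 3,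
n_1 = n−2 and n_2 = n_3 = 1. -/
theorem statement6 (n t : ℕ) (hn : 7 ≤ n) (ht : 3 ≤ t)
    (a : Fin t → ℕ) (hpos : ∀ i, 0 < a i)
    (hmono : ∀ i j : Fin t, i ≤ j → a j ≤ a i)
    (hsum : ∑ i, a i = n) :
    2 * (n - 1) <
        ∑ p ∈ Finset.univ.filter (fun p : Fin t × Fin t => p.1 < p.2), a p.1 * a p.2 ∨
      (t = 3 ∧ a ⟨0, by omega⟩ = n - 2 ∧ a ⟨1, by omega⟩ = 1 ∧ a ⟨2, by omega⟩ = 1) := by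
  have hsq := sum_sq_eq_sum_sq_add_two_mul_sum_lt a
  rw [hsum] at hsq
  generalize (∑ p ∈ Finset.univ.filter (fun p : Fin t × Fin t => p.1 < p.2),
    a p.1 * a p.2) = P at hsq ⊢
  have hle : ∑ i, a i ^ 2 ≤ a ⟨0, by omega⟩ * n := by
    rw [← hsum, Finset.mul_sum]
    refine Finset.sum_le_sum fun i _ => ?_
    rw [sq]
    exact Nat.mul_le_mul_right _ (hmono _ i (Nat.zero_le i))
  have hhead : a ⟨0, by omega⟩ + (t - 1) ≤ n := by
    obtain ⟨s, rfl⟩ : ∃ s, t = s + 1 := ⟨t - 1, by omega⟩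
    have htail : s ≤ ∑ i : Fin s, a i.succ := by
      simpa using Finset.card_nsmul_le_sum Finset.univ (fun i : Fin s => a i.succ) 1
        fun i _ => hpos i.succ
    rw [← hsum, Fin.sum_univ_succ]
    exact Nat.add_le_add_left htail _
  by_cases hm : a ⟨0, by omega⟩ + 4 ≤ n
  · left
    have : (a ⟨0, by omega⟩ + 4) * n ≤ n * n := Nat.mul_le_mul_right n hm
    have : n ^ 2 = n * n := sq n
    have : (a ⟨0, by omega⟩ + 4) * n = a ⟨0, by omega⟩ * n + 4 * n := add_mul _ _ _
    omega
  · obtain rfl | rfl : t = 3 ∨ t = 4 := by omega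
    · change ¬ a 0 + 4 ≤ n at hm
      change a 0 + (3 - 1) ≤ n at hhead
      have h1 := hpos 1
      have h2 := hpos 2
      have h12 : a 2 ≤ a 1 := hmono 1 2 (by decide)
      simp only [Fin.sum_univ_three] at hsum hsq
      by_cases h : a 1 = 1
      · right
        exact ⟨rfl, show a 0 = n - 2 by omega, h, show a 2 = 1 by omega⟩
      · left
        have e1 : a 1 = 2 := by omega
        have e2 : a 2 = 1 := by omega
        rw [← hsum, e1, e2] at hsq
        have : P = 3 * a 0 + 2 := by linarith
        omega
    · left
      change ¬ a 0 + 4 ≤ n at hm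
      have h1 := hpos 1
      have h2 := hpos 2
      have h3 := hpos 3
      simp only [Fin.sum_univ_four] at hsum hsq
      have e1 : a 1 = 1 := by omega
      have e2 : a 2 = 1 := by omega
      have e3 : a 3 = 1 := by omega
      rw [← hsum, e1, e2, e3] at hsq
      have : P = 3 * a 0 + 3 := by linarith
      omega
end

section
/- Let n ≥ 7, let M be a special real n×n matrix with g_M(n) ≤ 2(n−1)!, and let α ∈ {1,...,n} be such that the row R_α of M is non-zero. Then R_α is the (x,r_1,r_2)-row for some nonzero x ∈ ℝ and distinct r_1, r_2 ∈ {2,...,n}, or R_α is the (y,s)-row for some nonzero y ∈ ℝ and s ∈ {2,...,n}. -/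
open Finset

/-- A real n×n matrix (rows/columns indexed by `Fin n`, with index 0 playing the role
of "1") is special if it is non-zero, its first row and first column are zero, and all
its row sums are zero. -/
def IsSpecial (n : ℕ) [NeZero n] (M : Matrix (Fin n) (Fin n) ℝ) : Prop :=
  M ≠ 0 ∧ (∀ i, M i 0 = 0) ∧ (∀ j, M 0 j = 0) ∧ (∀ i, ∑ j, M i j = 0)

/-- R_α is the (x,r₁,r₂)-row: m_{α,r₁} = x, m_{α,r₂} = −x, all other entries 0. -/
def IsXRow (n : ℕ) (M : Matrix (Fin n) (Fin n) ℝ) (α : Fin n) (x : ℝ)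
    (r₁ r₂ : Fin n) : Prop :=
  M α r₁ = x ∧ M α r₂ = -x ∧ ∀ j, j ≠ r₁ → j ≠ r₂ → M α j = 0

/-- R_α is the (y,s)-row: m_{α,s} = (n−2)y, m_{α,1} = 0 and m_{α,j} = −y otherwise. -/
def IsYRow (n : ℕ) [NeZero n] (M : Matrix (Fin n) (Fin n) ℝ) (α : Fin n) (y : ℝ)
    (s : Fin n) : Prop :=
  M α s = ((n : ℝ) - 2) * y ∧ M α 0 = 0 ∧ ∀ j, j ≠ 0 → j ≠ s → M α j = -y

theorem exists_perm_apply_eq_apply_eq {ι : Type*} [DecidableEq ι] {i j a b : ι}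
    (hij : i ≠ j) (hab : a ≠ b) : ∃ τ : Equiv.Perm ι, τ i = a ∧ τ j = b := by
  refine ⟨Equiv.swap (Equiv.swap i a j) b * Equiv.swap i a, ?_, ?_⟩
  · rw [Equiv.Perm.mul_apply, Equiv.swap_apply_left]
    refine Equiv.swap_apply_of_ne_of_ne ?_ hab
    intro h
    apply hij
    apply (Equiv.swap i a).injective
    rw [Equiv.swap_apply_left]
    exact h
  · simp

open scoped Classical in
/-- The number of permutations sending `i` and `j` to points with distinct values of `v`
does not depend on the pair `i ≠ j`. -/
theorem card_perm_apply_ne_eq {ι : Type*} [Fintype ι] [DecidableEq ι] (v : ι → ℝ) {i j a b : ι}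
    (hij : i ≠ j) (hab : a ≠ b) :
    #{π : Equiv.Perm ι | v (π i) ≠ v (π j)} = #{π : Equiv.Perm ι | v (π a) ≠ v (π b)} := by
  obtain ⟨τ, rfl, rfl⟩ := exists_perm_apply_eq_apply_eq hij hab
  symm
  refine Finset.card_bij' (fun π _ => π * τ) (fun π _ => π * τ⁻¹) ?_ ?_ ?_ ?_ <;> simp

open scoped Classical in
/-- Double counting of triples `(π, i, j)` with `v (π i) ≠ v (π j)`. -/
theorem card_mul_card_perm_apply_ne {ι : Type*} [Fintype ι] [DecidableEq ι] (v : ι → ℝ) {a b : ι}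
    (hab : a ≠ b) :
    Fintype.card ι * (Fintype.card ι - 1) * #{π : Equiv.Perm ι | v (π a) ≠ v (π b)} =
      (Fintype.card ι).factorial * #{p : ι × ι | v p.1 ≠ v p.2} := by
  have h₁ : ∑ p : ι × ι, #{π : Equiv.Perm ι | v (π p.1) ≠ v (π p.2)} =
      ∑ p ∈ (univ : Finset ι).offDiag, #{π : Equiv.Perm ι | v (π a) ≠ v (π b)} := by
    symm
    rw [← Finset.sum_subset (Finset.subset_univ (univ : Finset ι).offDiag)]
    · refine Finset.sum_congr rfl fun p hp => ?_
      exact (card_perm_apply_ne_eq v (Finset.mem_offDiag.1 hp).2.2 hab).symm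
    · intro p _ hp
      simp only [Finset.mem_offDiag, Finset.mem_univ, true_and, not_not] at hp
      simp [hp]
  have h₂ : ∑ p : ι × ι, #{π : Equiv.Perm ι | v (π p.1) ≠ v (π p.2)} =
      ∑ π : Equiv.Perm ι, #{p : ι × ι | v (π p.1) ≠ v (π p.2)} := by
    simp only [Finset.card_filter]
    exact Finset.sum_comm
  have h₃ : ∀ π : Equiv.Perm ι, #{p : ι × ι | v (π p.1) ≠ v (π p.2)} =
      #{p : ι × ι | v p.1 ≠ v p.2} := by
    intro π
    refine Finset.card_bij' (fun p _ => (π p.1, π p.2)) (fun p _ => (π.symm p.1, π.symm p.2))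
      ?_ ?_ ?_ ?_ <;> simp
  rw [h₂, Finset.sum_congr rfl fun π _ => h₃ π, Finset.sum_const, Finset.sum_const,
    Finset.offDiag_card, Finset.card_univ, Finset.card_univ, Fintype.card_perm,
    smul_eq_mul, smul_eq_mul] at h₁
  rw [h₁, Nat.mul_sub, mul_one]

open scoped Classical in
theorem card_apply_ne_le_two_mul_gMn {n : ℕ} {M : Matrix (Fin n) (Fin n) ℝ} {α β : Fin n}
    (hβ : ∀ j, M β j = 0) (hαβ : α ≠ β) :
    #{π : Equiv.Perm (Fin n) | M α (π α) ≠ M α (π β)} ≤ 2 * gMn n M := by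
  set A : Finset (Equiv.Perm (Fin n)) := {π | ∑ i, M i (π i) ≠ 0} with hA
  set σ := Equiv.swap α β
  have hsub : ({π | M α (π α) ≠ M α (π β)} : Finset (Equiv.Perm (Fin n))) ⊆
      A ∪ A.image (· * σ) := by
    intro π hπ
    rw [Finset.mem_filter] at hπ
    by_contra hcon
    rw [Finset.mem_union, not_or] at hcon
    obtain ⟨h₁, h₂⟩ := hcon
    have h₁' : ∑ i, M i (π i) = 0 := by simpa [hA] using h₁
    have h₂' : ∑ i, M i ((π * σ) i) = 0 := by
      by_contra h
      refine h₂ (Finset.mem_image.2 ⟨π * σ, by simpa [hA] using h, ?_⟩)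
      simp [σ, mul_assoc]
    have hdiff : ∑ i, (M i (π i) - M i ((π * σ) i)) = M α (π α) - M α (π β) := by
      rw [Finset.sum_eq_single α]
      · simp [σ]
      · intro i _ hi
        by_cases hib : i = β
        · subst hib
          simp [hβ]
        · simp [σ, Equiv.swap_apply_of_ne_of_ne hi hib]
      · simp
    rw [Finset.sum_sub_distrib, h₁', h₂', sub_zero] at hdiff
    exact hπ.2 (sub_eq_zero.1 hdiff.symm)
  calc _ ≤ #(A ∪ A.image (· * σ)) := Finset.card_le_card hsub
    _ ≤ #A + #(A.image (· * σ)) := Finset.card_union_le _ _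
    _ ≤ #A + #A := Nat.add_le_add_left Finset.card_image_le _
    _ = 2 * #A := (two_mul _).symm
    _ = 2 * gMn n M := rfl

open scoped Classical in
theorem card_ne_pairs_le {n : ℕ} (hn : 2 ≤ n) {M : Matrix (Fin n) (Fin n) ℝ} {α β : Fin n}
    (hβ : ∀ j, M β j = 0) (hαβ : α ≠ β) (hg : gMn n M ≤ 2 * (n - 1).factorial) :
    #{p : Fin n × Fin n | M α p.1 ≠ M α p.2} ≤ 4 * (n - 1) := by
  have h₁ := card_mul_card_perm_apply_ne (M α) hαβ
  have h₂ := card_apply_ne_le_two_mul_gMn hβ hαβ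
  rw [Fintype.card_fin] at h₁
  refine Nat.le_of_mul_le_mul_left ?_ n.factorial_pos
  rw [← h₁]
  refine (Nat.mul_le_mul_left _ (h₂.trans (Nat.mul_le_mul_left 2 hg))).trans_eq ?_
  rw [← Nat.mul_factorial_pred (by omega : n ≠ 0)]
  ring

open scoped Classical in
theorem card_ne_pairs_eq_sum {ι : Type*} [Fintype ι] (v : ι → ℝ) :
    #{p : ι × ι | v p.1 ≠ v p.2} = ∑ a, #{b | v b ≠ v a} := by
  simp only [Finset.card_filter]
  rw [Fintype.sum_prod_type]
  simp only [ne_comm]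

open scoped Classical in
/-- If `v` has at least three distinct values and few pairs of points with distinct values,
then some value is taken at all but two points. -/
theorem exists_card_ne_le_two {ι : Type*} [Fintype ι] [Nonempty ι] (hn : 7 ≤ Fintype.card ι)
    (v : ι → ℝ) (h₃ : ∀ x y : ℝ, ∃ i, v i ≠ x ∧ v i ≠ y)
    (hD : #{p : ι × ι | v p.1 ≠ v p.2} ≤ 4 * (Fintype.card ι - 1)) :
    ∃ a, #{b | v b ≠ v a} ≤ 2 := by
  by_contra! hcon
  rw [card_ne_pairs_eq_sum] at hD
  by_cases h4 : ∀ a, 4 ≤ #{b | v b ≠ v a}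
  · have := Finset.card_nsmul_le_sum univ (fun a => #{b | v b ≠ v a}) 4 fun a _ => h4 a
    rw [smul_eq_mul, Finset.card_univ] at this
    omega
  push Not at h4
  obtain ⟨a, ha⟩ := h4
  have ha3 : #{b | v b ≠ v a} = 3 := by have := hcon a; omega
  have hsplit := Finset.card_filter_add_card_filter_not (s := (univ : Finset ι))
    (fun b => v b ≠ v a)
  rw [ha3, Finset.card_univ] at hsplit
  have hlarge : ∀ b, v b ≠ v a → Fintype.card ι - 2 ≤ #{c | v c ≠ v b} := by
    intro b hb
    obtain ⟨d, hda, hdb⟩ := h₃ (v a) (v b)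
    have hd : d ∉ ({c | ¬ v c ≠ v a} : Finset ι) := by simpa using hda
    have hsub : insert d ({c | ¬ v c ≠ v a} : Finset ι) ⊆ ({c | v c ≠ v b} : Finset ι) := by
      intro c hc
      rw [Finset.mem_insert] at hc
      rcases hc with rfl | hc
      · simpa using hdb
      · have hca : v c = v a := by simpa using hc
        simpa [hca] using hb.symm
    have := Finset.card_le_card hsub
    rw [Finset.card_insert_of_notMem hd] at this
    omega
  have e₁ := Finset.card_nsmul_le_sum ({c | v c ≠ v a} : Finset ι)
    (fun a => #{b | v b ≠ v a}) (Fintype.card ι - 2)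
    fun b hb => hlarge b (Finset.mem_filter.1 hb).2
  have e₂ := Finset.card_nsmul_le_sum ({c | ¬ v c ≠ v a} : Finset ι)
    (fun a => #{b | v b ≠ v a}) 3 fun b _ => hcon b
  have e₃ := Finset.sum_filter_add_sum_filter_not (univ : Finset ι) (fun b => v b ≠ v a)
    (fun a => #{b | v b ≠ v a})
  rw [smul_eq_mul] at e₁ e₂
  rw [ha3] at e₁
  omega

theorem exists_ne_ne_of_sum_eq_zero {ι : Type*} [Fintype ι] {v : ι → ℝ} {z : ι}
    (hz : v z = 0) (hsum : ∑ i, v i = 0) (hv : v ≠ 0) (x y : ℝ) :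
    ∃ i, v i ≠ x ∧ v i ≠ y := by
  obtain ⟨i, hi⟩ : ∃ i, v i ≠ 0 := Function.ne_iff.1 hv
  have hpos : ∃ p, 0 < v p := by
    by_contra! h
    exact hi ((Finset.sum_eq_zero_iff_of_nonpos fun i _ => h i).1 hsum i (mem_univ i))
  have hneg : ∃ q, v q < 0 := by
    by_contra! h
    exact hi ((Finset.sum_eq_zero_iff_of_nonneg fun i _ => h i).1 hsum i (mem_univ i))
  obtain ⟨p, hp⟩ := hpos
  obtain ⟨q, hq⟩ := hneg
  by_contra! h
  have h₁ := h z
  have h₂ := h p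
  have h₃ := h q
  grind

/-- Lemma 5: for n ≥ 7 and a special matrix M with g_M(n) ≤ 2(n−1)!,
every non-zero row of M is an (x,r₁,r₂)-row (x ≠ 0, r₁ ≠ r₂ in {2,...,n}) or a
(y,s)-row (y ≠ 0, s ∈ {2,...,n}). -/
theorem statement7 (n : ℕ) [NeZero n] (hn : 7 ≤ n) (M : Matrix (Fin n) (Fin n) ℝ)
    (hM : IsSpecial n M) (hg : gMn n M ≤ 2 * Nat.factorial (n - 1))
    (α : Fin n) (hα : M α ≠ 0) :
    (∃ x : ℝ, x ≠ 0 ∧ ∃ r₁ r₂ : Fin n, r₁ ≠ 0 ∧ r₂ ≠ 0 ∧ r₁ ≠ r₂ ∧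
        IsXRow n M α x r₁ r₂) ∨
      (∃ y : ℝ, y ≠ 0 ∧ ∃ s : Fin n, s ≠ 0 ∧ IsYRow n M α y s) := by
  classical
  obtain ⟨-, hcol, hrow, hsum⟩ := hM
  have hα0 : α ≠ 0 := by
    rintro rfl
    exact hα (funext hrow)
  have h₃ := exists_ne_ne_of_sum_eq_zero (hcol α) (hsum α) hα
  obtain ⟨a, ha⟩ := exists_card_ne_le_two (by simpa using hn) (M α) h₃
    (by simpa using card_ne_pairs_le (by omega) hrow hα0 hg)
  obtain ⟨b, hba, -⟩ := h₃ (M α a) (M α a)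
  obtain ⟨c, hca, hcb⟩ := h₃ (M α a) (M α b)
  have hbc : b ≠ c := by
    rintro rfl
    exact hcb rfl
  have hsub : ({b, c} : Finset (Fin n)) ⊆ ({d | M α d ≠ M α a} : Finset (Fin n)) := by
    intro d hd
    rw [Finset.mem_insert, Finset.mem_singleton] at hd
    rcases hd with rfl | rfl <;> simpa
  have heq := Finset.eq_of_subset_of_card_le hsub (by rwa [Finset.card_pair hbc])
  have hrest : ∀ d, d ≠ b → d ≠ c → M α d = M α a := by
    intro d hdb hdc
    by_contra h
    have : d ∈ ({b, c} : Finset (Fin n)) := by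
      rw [heq]
      simpa using h
    simp [hdb, hdc] at this
  have htotal : M α b + M α c + ((n : ℝ) - 2) * M α a = 0 := by
    have hsplit := Finset.sum_sdiff (f := M α) (Finset.subset_univ ({b, c} : Finset (Fin n)))
    have hconst : ∑ d ∈ univ \ {b, c}, M α d = ∑ d ∈ univ \ {b, c}, M α a :=
      Finset.sum_congr rfl fun d hd => by
        simp only [Finset.mem_sdiff, Finset.mem_insert, Finset.mem_singleton, not_or] at hd
        exact hrest d hd.2.1 hd.2.2
    rw [hconst, Finset.sum_pair hbc, hsum α, Finset.sum_const,
      Finset.card_sdiff_of_subset (Finset.subset_univ _), Finset.card_pair hbc, Finset.card_univ,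
      Fintype.card_fin, nsmul_eq_mul, Nat.cast_sub (by omega)] at hsplit
    push_cast at hsplit
    linarith
  by_cases h0 : M α a = 0
  · left
    refine ⟨M α b, by rwa [h0] at hba, b, c, ?_, ?_, hbc, rfl, ?_, ?_⟩
    · rintro rfl
      exact hba ((hcol α).trans h0.symm)
    · rintro rfl
      exact hca ((hcol α).trans h0.symm)
    · rw [h0] at htotal
      linarith
    · intro j hjb hjc
      rw [hrest j hjb hjc, h0]
  · right
    refine ⟨-M α a, neg_ne_zero.2 h0, ?_⟩
    have hbc0 : b = 0 ∨ c = 0 := by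
      by_contra! h
      exact h0 ((hrest 0 h.1.symm h.2.symm).symm.trans (hcol α))
    rcases hbc0 with rfl | rfl
    · refine ⟨c, hbc.symm, ?_, hcol α, fun j hj hjc => by rw [hrest j hj hjc, neg_neg]⟩
      rw [hcol α] at htotal
      linarith
    · refine ⟨b, hbc, ?_, hcol α, fun j hj hjb => by rw [hrest j hjb hj, neg_neg]⟩
      rw [hcol α] at htotal
      linarith
end

section
/- Let n ≥ 8, let M be a special real n×n matrix with g_M(n) ≤ 2(n−1)!, and let α, β ∈ {1,...,n} with α ≠ β and R_α ≠ R_β. Then there exists a partition (A,B) of {1,...,n} with |A| = 2 such that the rows R_α and R_β have the (A,B)-property. -/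
open Finset

theorem exists_perm_apply_eq_and_apply_eq {ι : Type*} [DecidableEq ι] {α β a b : ι}
    (hαβ : α ≠ β) (hab : a ≠ b) : ∃ τ : Equiv.Perm ι, τ α = a ∧ τ β = b := by
  have h : Equiv.swap α a β ≠ a := by
    intro h
    rw [Equiv.swap_apply_eq_iff, Equiv.swap_apply_right] at h
    exact hαβ h.symm
  refine ⟨Equiv.swap (Equiv.swap α a β) b * Equiv.swap α a, ?_, ?_⟩
  · rw [Equiv.Perm.mul_apply, Equiv.swap_apply_left, Equiv.swap_apply_of_ne_of_ne h.symm hab]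
  · rw [Equiv.Perm.mul_apply, Equiv.swap_apply_left]

/-- At least `(|ι| - 2)!` permutations take two prescribed distinct values at two given points. -/
theorem factorial_le_card_perm_filter {ι : Type*} [Fintype ι] [DecidableEq ι] {α β a b : ι}
    (hαβ : α ≠ β) (hab : a ≠ b) :
    (Fintype.card ι - 2).factorial ≤
      #{π : Equiv.Perm ι | π α = a ∧ π β = b} := by
  obtain ⟨τ, hτα, hτβ⟩ := exists_perm_apply_eq_and_apply_eq hαβ hab
  have hcard : Fintype.card {x // x ∉ ({α, β} : Finset ι)} = Fintype.card ι - 2 := by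
    rw [Fintype.card_subtype_compl, Fintype.card_coe, card_pair hαβ]
  rw [← hcard, ← Fintype.card_perm, ← card_univ]
  refine card_le_card_of_injOn (fun f => τ * Equiv.Perm.ofSubtype f) ?_ ?_
  · intro f _
    have hα : Equiv.Perm.ofSubtype f α = α :=
      Equiv.Perm.ofSubtype_apply_of_not_mem f (by simp)
    have hβ : Equiv.Perm.ofSubtype f β = β :=
      Equiv.Perm.ofSubtype_apply_of_not_mem f (by simp)
    simp [hα, hβ, hτα, hτβ]
  · intro f _ g _ h
    exact Equiv.Perm.ofSubtype_injective (mul_left_cancel h)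

theorem mul_factorial_le_card_perm_filter {ι : Type*} [Fintype ι] [DecidableEq ι] {α β : ι}
    (hαβ : α ≠ β) (S : Finset ι) :
    #S * #Sᶜ * (Fintype.card ι - 2).factorial ≤
      #{π : Equiv.Perm ι | π α ∈ S ∧ π β ∉ S} := by
  rw [mul_comm, ← card_product]
  refine mul_card_image_le_card_of_maps_to (f := fun π : Equiv.Perm ι => (π α, π β)) ?_ _ ?_
  · simp
  · rintro ⟨a, b⟩ hab
    rw [mem_product, mem_compl] at hab
    have hne : a ≠ b := fun h => hab.2 (h ▸ hab.1)
    refine (factorial_le_card_perm_filter hαβ hne).trans (card_le_card fun π hπ => ?_)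
    simp only [mem_filter, mem_univ, true_and, Prod.mk.injEq] at hπ ⊢
    exact ⟨by rw [hπ.1, hπ.2]; exact hab, hπ⟩

/-- Exchanging the images of two rows changes the diagonal sum by a mixed difference. -/
theorem sum_apply_sub_sum_apply_mul_swap {ι : Type*} [Fintype ι] [DecidableEq ι]
    (M : Matrix ι ι ℝ) {α β : ι} (hαβ : α ≠ β) (π : Equiv.Perm ι) :
    ∑ i, M i (π i) - ∑ i, M i ((π * Equiv.swap α β) i) =
      (M α (π α) - M β (π α)) - (M α (π β) - M β (π β)) := by
  rw [← Finset.sum_sub_distrib, Fintype.sum_eq_add α β hαβ]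
  · simp only [Equiv.Perm.mul_apply, Equiv.swap_apply_left, Equiv.swap_apply_right]
    ring
  · rintro x ⟨hα, hβ⟩
    simp [Equiv.swap_apply_of_ne_of_ne hα hβ]

/-- A set `S` of columns on which the difference of two rows takes no value taken outside `S`
forces many nonzero diagonal sums. -/
theorem mul_factorial_le_gMn {n : ℕ} (M : Matrix (Fin n) (Fin n) ℝ) {α β : Fin n} (hαβ : α ≠ β)
    (S : Finset (Fin n)) (hS : ∀ a ∈ S, ∀ b ∉ S, M α a - M β a ≠ M α b - M β b) :
    #S * #Sᶜ * (n - 2).factorial ≤ gMn n M := by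
  classical
  have h := mul_factorial_le_card_perm_filter hαβ S
  rw [Fintype.card_fin] at h
  refine h.trans ?_
  unfold gMn gM
  refine card_le_card_of_injOn
    (fun π => if ∑ i, M i (π i) ≠ 0 then π else π * Equiv.swap α β) ?_ ?_
  · intro π hπ
    simp only [coe_filter, mem_univ, true_and, Set.mem_ofPred_eq] at hπ ⊢
    split_ifs with h0
    · exact h0
    · intro h1
      have h2 := sum_apply_sub_sum_apply_mul_swap M hαβ π
      rw [not_not.mp h0, h1, sub_zero] at h2
      exact hS _ hπ.1 _ hπ.2 (sub_eq_zero.mp h2.symm)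
  · intro π hπ σ hσ hπσ
    simp only [coe_filter, mem_univ, true_and, Set.mem_ofPred_eq] at hπ hσ
    have hmul : ∀ {π σ : Equiv.Perm (Fin n)}, σ β ∉ S → π α ∈ S →
        π ≠ σ * Equiv.swap α β := by
      rintro π σ hσ hπ rfl
      simp [hσ] at hπ
    dsimp only at hπσ
    split_ifs at hπσ
    · exact hπσ
    · exact absurd hπσ (hmul hσ.2 hπ.1)
    · exact absurd hπσ.symm (hmul hπ.2 hσ.1)
    · exact mul_right_cancel hπσ

/-- A function on at least two points that is not constant off any single point either has a
separated pair of points, or a fibre that has, like its complement, at least three elements. -/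
theorem exists_pair_or_exists_fiber {ι R : Type*} [Fintype ι] [DecidableEq ι] [DecidableEq R]
    (d : ι → R) (hι : 2 ≤ Fintype.card ι) (hd : ∀ i, ∃ j k, j ≠ i ∧ k ≠ i ∧ d j ≠ d k) :
    (∃ A : Finset ι, #A = 2 ∧ ∀ a ∈ A, ∀ b ∉ A, d a ≠ d b) ∨
      ∃ v, 3 ≤ #{j | d j = v} ∧ 3 ≤ #({j | d j = v} : Finset ι)ᶜ := by
  by_cases h2 : ∃ v, #{j | d j = v} = 2
  · obtain ⟨v, hv⟩ := h2
    refine Or.inl ⟨_, hv, ?_⟩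
    intro a ha b hb
    simp only [mem_filter, mem_univ, true_and] at ha hb
    exact fun h => hb (h ▸ ha)
  push Not at h2
  by_cases h3 : ∃ v, 3 ≤ #{j | d j = v}
  · obtain ⟨v, hv⟩ := h3
    by_contra! hcon
    have hlt := hcon.2 v hv
    by_cases hc : #({j | d j = v} : Finset ι)ᶜ = 2
    · obtain ⟨a, ha, b, hb, hab⟩ := hcon.1 _ hc
      simp only [mem_compl, mem_filter, mem_univ, true_and, not_not] at ha hb
      exact ha (hab.trans hb)
    · have : Nonempty ι := Fintype.card_pos_iff.mp (by omega)
      obtain ⟨i, hi⟩ := card_le_one_iff_subset_singleton.mp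
        (show #({j | d j = v} : Finset ι)ᶜ ≤ 1 by omega)
      obtain ⟨j, k, hj, hk, hjk⟩ := hd i
      have hmem : ∀ x, x ≠ i → d x = v := fun x hx => by
        by_contra hxv
        exact hx (mem_singleton.mp (hi (by simpa using hxv)))
      exact hjk ((hmem j hj).trans (hmem k hk).symm)
  · push Not at h3
    obtain ⟨A, -, hA⟩ := exists_subset_card_eq (s := (univ : Finset ι)) hι
    refine Or.inl ⟨A, hA, fun a ha b hb hab => ?_⟩
    have hle : #{j | d j = d b} ≤ 1 := by
      have := h2 (d b)
      have := h3 (d b)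
      omega
    have : a = b := card_le_one.mp hle a (by simpa using hab) b (by simp)
    exact hb (this ▸ ha)

/-- Lemma 6: for n ≥ 8 and a special matrix M with g_M(n) ≤ 2(n−1)!,
any two distinct, unequal rows R_α, R_β of M have the (A,B)-property for some
partition (A,B) of {1,...,n} with |A| = 2. -/
theorem statement8 (n : ℕ) [NeZero n] (hn : 8 ≤ n) (M : Matrix (Fin n) (Fin n) ℝ)
    (hM : IsSpecial n M) (hg : gMn n M ≤ 2 * Nat.factorial (n - 1))
    (α β : Fin n) (hαβ : α ≠ β) (hrows : M α ≠ M β) :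
    ∃ A B : Finset (Fin n), Disjoint A B ∧ A ∪ B = Finset.univ ∧ A.card = 2 ∧
      ∀ a ∈ A, ∀ b ∈ B, M α a + M β b ≠ M α b + M β a := by
  obtain ⟨-, hcol, -, hsum⟩ := hM
  have hd : ∀ i, ∃ j k, j ≠ i ∧ k ≠ i ∧ M α j - M β j ≠ M α k - M β k := by
    by_contra! h
    obtain ⟨i, hi⟩ := h
    have hdsum : ∑ j, (M α j - M β j) = 0 := by
      rw [Finset.sum_sub_distrib, hsum, hsum, sub_zero]
    have hoff : ∀ j, j ≠ i → M α j - M β j = 0 := by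
      intro j hj
      by_cases h0 : (0 : Fin n) = i
      · have hconst : ∑ k ∈ univ.erase i, (M α k - M β k) = (n - 1 : ℕ) • (M α j - M β j) := by
          rw [sum_congr rfl fun k hk => hi k j (ne_of_mem_erase hk) hj, sum_const,
            card_erase_of_mem (mem_univ i), card_univ, Fintype.card_fin]
        rw [← add_sum_erase _ _ (mem_univ i), hconst, ← h0, hcol, hcol, sub_zero, zero_add,
          smul_eq_zero] at hdsum
        exact hdsum.resolve_left (by omega)
      · rw [hi j 0 hj h0, hcol, hcol, sub_zero]
    have hat : M α i - M β i = 0 := by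
      rwa [Fintype.sum_eq_single i hoff] at hdsum
    refine hrows (funext fun j => sub_eq_zero.mp ?_)
    by_cases hj : j = i
    · rw [hj, hat]
    · exact hoff j hj
  rcases exists_pair_or_exists_fiber (fun j => M α j - M β j)
      (by rw [Fintype.card_fin]; omega) hd with ⟨A, hA, h⟩ | ⟨v, hv, hv'⟩
  · refine ⟨A, Aᶜ, disjoint_compl_right, union_compl A, hA, fun a ha b hb heq => ?_⟩
    exact h a ha b (mem_compl.mp hb) (by linarith)
  · exfalso
    have h := mul_factorial_le_gMn M hαβ {j | M α j - M β j = v} (fun a ha b hb => by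
      simp only [mem_filter, mem_univ, true_and] at ha hb
      exact fun hab => hb (hab ▸ ha))
    have hcard := card_add_card_compl ({j | M α j - M β j = v} : Finset (Fin n))
    rw [Fintype.card_fin] at hcard
    generalize #({j | M α j - M β j = v} : Finset (Fin n)) = s at *
    generalize #({j | M α j - M β j = v} : Finset (Fin n))ᶜ = t at *
    obtain ⟨m, rfl⟩ : ∃ m, n = m + 2 := ⟨n - 2, by omega⟩
    have hf := h.trans hg
    rw [Nat.add_sub_cancel, show m + 2 - 1 = m + 1 by omega, Nat.factorial_succ,
      ← mul_assoc] at hf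
    have hle := Nat.le_of_mul_le_mul_right hf m.factorial_pos
    obtain ⟨s, rfl⟩ := Nat.exists_eq_add_of_le hv
    obtain ⟨t, rfl⟩ := Nat.exists_eq_add_of_le hv'
    nlinarith [Nat.zero_le (s * t)]
end

section
/- Let n ≥ 8 or n = 3, and let M be a special real n×n matrix with g_M(n) ≤ 2(n−1)!. Then M is θ-uniform for some θ ∈ {1,...,n}, i.e., there exists θ such that all rows R_α of M with α ≠ θ are equal to each other. -/
open Finset

open scoped Classical in
/-- The indicator of being nonzero. -/
noncomputable def nz (x : ℝ) : ℕ := if x ≠ 0 then 1 else 0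

section Counting

variable {α : Type*} [Fintype α] [DecidableEq α]

lemma card_perm_eqOn (s : Finset α) (σ : Equiv.Perm α) :
    #{π : Equiv.Perm α | ∀ x ∈ s, π x = σ x} = (Fintype.card α - #s).factorial := by
  have h1 : #{π : Equiv.Perm α | ∀ x ∈ s, π x = σ x} =
      #{π : Equiv.Perm α | ∀ x, ¬ x ∉ s → π x = x} := by
    refine Finset.card_bij' (fun π _ => σ⁻¹ * π) (fun π _ => σ * π) ?_ ?_ ?_ ?_
    · intro π hπ
      simp only [mem_filter, mem_univ, true_and] at hπ ⊢
      intro x hx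
      simp [hπ x (not_not.mp hx)]
    · intro π hπ
      simp only [mem_filter, mem_univ, true_and] at hπ ⊢
      intro x hx
      simp [hπ x (not_not.mpr hx)]
    · intro π _; simp
    · intro π _; simp
  rw [h1, ← Fintype.card_subtype,
    ← Fintype.card_congr (Equiv.Perm.subtypeEquivSubtypePerm (fun x => x ∉ s)),
    Fintype.card_perm]
  congr 1
  rw [Fintype.card_subtype_compl]
  simp

lemma card_perm_map_eq (i a : α) :
    #{π : Equiv.Perm α | π i = a} = (Fintype.card α - 1).factorial := by
  simpa using card_perm_eqOn {i} (Equiv.swap i a)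

lemma card_perm_map_pair_eq {i k a b : α} (hik : i ≠ k) (hab : a ≠ b) :
    #{π : Equiv.Perm α | π i = a ∧ π k = b} = (Fintype.card α - 2).factorial := by
  have h := card_perm_eqOn {i, k} (Equiv.swap (Equiv.swap i a k) b * Equiv.swap i a)
  have h1 : Equiv.swap (Equiv.swap i a k) b a = a := by
    refine Equiv.swap_apply_of_ne_of_ne ?_ hab
    intro h
    have := (Equiv.swap i a).injective ((Equiv.swap_apply_left i a).trans h)
    exact hik this
  simpa [h1, Finset.card_pair hik] using h

lemma sum_hit (I : Finset α) (a : α) :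
    ∑ π : Equiv.Perm α, (if π.symm a ∈ I then 1 else 0) =
      #I * (Fintype.card α - 1).factorial := by
  have h : ∀ π : Equiv.Perm α,
      (if π.symm a ∈ I then 1 else 0) = ∑ i ∈ I, if π i = a then 1 else 0 := by
    intro π
    simp_rw [← Equiv.eq_symm_apply]
    simp
  simp_rw [h]
  rw [Finset.sum_comm]
  simp_rw [← Finset.card_filter, card_perm_map_eq]
  simp

lemma sum_hit_pair (I : Finset α) {a b : α} (hab : a ≠ b) :
    ∑ π : Equiv.Perm α, (if π.symm a ∈ I ∧ π.symm b ∈ I then 1 else 0) =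
      #I.offDiag * (Fintype.card α - 2).factorial := by
  have h : ∀ π : Equiv.Perm α,
      (if π.symm a ∈ I ∧ π.symm b ∈ I then 1 else 0) =
        ∑ x ∈ I.offDiag, if π x.1 = a ∧ π x.2 = b then 1 else 0 := by
    intro π
    have h2 : ∀ x : α × α, (π x.1 = a ∧ π x.2 = b) ↔ (π.symm a, π.symm b) = x := by
      rintro ⟨x, y⟩
      simp only [Prod.mk.injEq, Equiv.symm_apply_eq]
      constructor <;> rintro ⟨rfl, rfl⟩ <;> simp
    simp_rw [h2]
    rw [Finset.sum_ite_eq]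
    simp [hab]
  simp_rw [h]
  rw [Finset.sum_comm]
  simp_rw [← Finset.card_filter]
  rw [Finset.sum_congr rfl (fun x hx =>
    card_perm_map_pair_eq (Finset.mem_offDiag.mp hx).2.2 hab)]
  simp

lemma sum_perm_pair {i k : α} (hik : i ≠ k) (P : α → α → Prop) [∀ p q, Decidable (P p q)]
    (hP : ∀ p, ¬ P p p) :
    ∑ π : Equiv.Perm α, (if P (π i) (π k) then 1 else 0) =
      (∑ p, ∑ q, if P p q then 1 else 0) * (Fintype.card α - 2).factorial := by
  have h : ∀ π : Equiv.Perm α, (if P (π i) (π k) then 1 else 0) =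
      ∑ p, ∑ q, if P p q then (if π i = p ∧ π k = q then 1 else 0) else 0 := by
    intro π
    rw [Finset.sum_eq_single (π i), Finset.sum_eq_single (π k)]
    · simp
    · intro q _ hq
      simp [hq.symm]
    · simp
    · intro p _ hp
      simp [hp.symm]
    · simp
  simp_rw [h]
  rw [Finset.sum_comm, Finset.sum_mul]
  refine Finset.sum_congr rfl fun p _ => ?_
  rw [Finset.sum_comm, Finset.sum_mul]
  refine Finset.sum_congr rfl fun q _ => ?_
  by_cases hpq : P p q
  · have hne : p ≠ q := by rintro rfl; exact hP p hpq
    simp only [hpq, if_true]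
    rw [← Finset.card_filter, card_perm_map_pair_eq hik hne, one_mul]
  · simp [hpq]

end Counting

section Values

lemma two_le_six_nz (C up uq ur vp vq vr : ℝ)
    (h : ¬ (up = uq ∧ up = ur ∧ vp = vq ∧ vp = vr)) :
    2 ≤ nz (C + up + vq) + nz (C + uq + vp) + nz (C + ur + vq) + nz (C + up + vr) +
      nz (C + uq + vr) + nz (C + ur + vp) := by
  unfold nz
  by_contra hlt
  apply h
  split_ifs at hlt <;> first
    | omega
    | (push Not at *; refine ⟨?_, ?_, ?_, ?_⟩ <;> linarith)

lemma four_le_six_nz (C up uq ur vp vq vr cu cv : ℝ)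
    (h : (up ≠ cu ∧ vp ≠ cv ∧ up - cu ≠ vp - cv ∧ uq = cu ∧ ur = cu ∧ vq = cv ∧ vr = cv) ∨
      (uq ≠ cu ∧ vq ≠ cv ∧ uq - cu ≠ vq - cv ∧ up = cu ∧ ur = cu ∧ vp = cv ∧ vr = cv) ∨
      (ur ≠ cu ∧ vr ≠ cv ∧ ur - cu ≠ vr - cv ∧ up = cu ∧ uq = cu ∧ vp = cv ∧ vq = cv)) :
    4 ≤ nz (C + up + vq) + nz (C + uq + vp) + nz (C + ur + vq) + nz (C + up + vr) +
      nz (C + uq + vr) + nz (C + ur + vp) := by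
  unfold nz
  rcases h with ⟨h1, h2, h3, rfl, h4, rfl, h5⟩ | ⟨h1, h2, h3, rfl, h4, rfl, h5⟩ |
      ⟨h1, h2, h3, rfl, h4, rfl, h5⟩ <;> subst h4 <;> subst h5 <;> split_ifs <;> first
    | omega
    | (exfalso; push Not at *; first
        | (apply h1; linarith)
        | (apply h2; linarith)
        | (apply h3; linarith))

lemma two_le_four_nz (C up uq ur us : ℝ) (h : ¬ (up = uq ∧ ur = us)) :
    2 ≤ nz (C + up + ur) + nz (C + uq + ur) + nz (C + up + us) + nz (C + uq + us) := by
  unfold nz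
  by_contra hlt
  apply h
  split_ifs at hlt <;> first
    | omega
    | (push Not at *; refine ⟨?_, ?_⟩ <;> linarith)

lemma one_le_two_nz (C up uq : ℝ) (h : up ≠ uq) :
    1 ≤ nz (C + up) + nz (C + uq) := by
  unfold nz
  by_contra hlt
  apply h
  split_ifs at hlt <;> first
    | omega
    | (push Not at *; linarith)

end Values

section Diagonals

variable {n : ℕ} {M : Matrix (Fin n) (Fin n) ℝ}

lemma gMn_eq_sum_nz (σ : Equiv.Perm (Fin n)) :
    gMn n M = ∑ π : Equiv.Perm (Fin n), nz (∑ x, M x (π (σ x))) := by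
  refine Eq.trans ?_ (Equiv.sum_comp (Equiv.mulRight σ)
    (fun π : Equiv.Perm (Fin n) => nz (∑ x, M x (π x)))).symm
  simp only [gMn, gM, nz, Finset.card_filter]

lemma sum_diag_eq (hsum : ∀ i, ∑ j, M i j = 0) (l : Fin n) (I : Finset (Fin n))
    (σ π : Equiv.Perm (Fin n)) (hσ : ∀ x, x ∉ I → σ x = x) :
    ∑ x, M x (π (σ x)) =
      (∑ x ∈ Iᶜ, (M x - M l) (π x)) + ∑ x ∈ I, (M x - M l) (π (σ x)) := by
  have h0 : ∑ x, M l (π (σ x)) = 0 := by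
    rw [← hsum l]
    exact Equiv.sum_comp (σ.trans π) (M l)
  have h1 : ∑ x ∈ Iᶜ, (M x - M l) (π x) = ∑ x ∈ Iᶜ, (M x - M l) (π (σ x)) :=
    Finset.sum_congr rfl fun x hx => by rw [hσ x (Finset.mem_compl.mp hx)]
  rw [h1, Finset.sum_compl_add_sum]
  simp [Finset.sum_sub_distrib, h0]

lemma two_mul_gMn (hsum : ∀ i, ∑ j, M i j = 0) {i k : Fin n} (hik : i ≠ k) :
    ∃ C : Equiv.Perm (Fin n) → ℝ, 2 * gMn n M =
      ∑ π, (nz (C π + (M i - M k) (π i)) + nz (C π + (M i - M k) (π k))) := by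
  refine ⟨fun π => ∑ x ∈ ({i, k} : Finset (Fin n))ᶜ, (M x - M k) (π x), ?_⟩
  rw [two_mul, Finset.sum_add_distrib]
  congr 1
  · rw [gMn_eq_sum_nz 1]
    refine Finset.sum_congr rfl fun π _ => ?_
    rw [sum_diag_eq hsum k {i, k} 1 π (by simp)]
    simp [Finset.sum_pair hik]
  · rw [gMn_eq_sum_nz (Equiv.swap i k)]
    refine Finset.sum_congr rfl fun π _ => ?_
    rw [sum_diag_eq hsum k {i, k} _ π (by
      intro x hx; simp at hx; exact Equiv.swap_apply_of_ne_of_ne hx.1 hx.2)]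
    simp [Finset.sum_pair hik]

lemma six_mul_gMn (hsum : ∀ i, ∑ j, M i j = 0) {i k l : Fin n} (hik : i ≠ k) (hil : i ≠ l)
    (hkl : k ≠ l) :
    ∃ C : Equiv.Perm (Fin n) → ℝ, 6 * gMn n M =
      ∑ π, (nz (C π + (M i - M l) (π i) + (M k - M l) (π k)) +
        nz (C π + (M i - M l) (π k) + (M k - M l) (π i)) +
        nz (C π + (M i - M l) (π l) + (M k - M l) (π k)) +
        nz (C π + (M i - M l) (π i) + (M k - M l) (π l)) +
        nz (C π + (M i - M l) (π k) + (M k - M l) (π l)) +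
        nz (C π + (M i - M l) (π l) + (M k - M l) (π i))) := by
  refine ⟨fun π => ∑ x ∈ ({i, k, l} : Finset (Fin n))ᶜ, (M x - M l) (π x), ?_⟩
  have key : ∀ (σ : Equiv.Perm (Fin n)) (p q : Fin n), σ i = p → σ k = q →
      (∀ x, x ∉ ({i, k, l} : Finset (Fin n)) → σ x = x) →
      gMn n M = ∑ π : Equiv.Perm (Fin n),
        nz (∑ x ∈ ({i, k, l} : Finset (Fin n))ᶜ, (M x - M l) (π x) +
          (M i - M l) (π p) + (M k - M l) (π q)) := by
    rintro σ _ _ rfl rfl hσ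
    rw [gMn_eq_sum_nz σ]
    refine Finset.sum_congr rfl fun π _ => ?_
    rw [sum_diag_eq hsum l _ σ π hσ, Finset.sum_insert (by simp [hik, hil]),
      Finset.sum_pair hkl]
    simp [add_assoc]
  simp only [Finset.sum_add_distrib]
  rw [← key 1 i k rfl rfl (by simp),
    ← key (Equiv.swap i k) k i (by simp) (by simp) (by
      intro x hx; simp at hx; exact Equiv.swap_apply_of_ne_of_ne hx.1 hx.2.1),
    ← key (Equiv.swap i l) l k (by simp) (Equiv.swap_apply_of_ne_of_ne hik.symm hkl) (by
      intro x hx; simp at hx; exact Equiv.swap_apply_of_ne_of_ne hx.1 hx.2.2),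
    ← key (Equiv.swap k l) i l (Equiv.swap_apply_of_ne_of_ne hik hil) (by simp) (by
      intro x hx; simp at hx; exact Equiv.swap_apply_of_ne_of_ne hx.2.1 hx.2.2),
    ← key (Equiv.swap i k * Equiv.swap k l) k l
      (by simp [Equiv.swap_apply_of_ne_of_ne hik hil])
      (by simp [Equiv.swap_apply_of_ne_of_ne hil.symm hkl.symm]) (by
      intro x hx; simp at hx
      simp [Equiv.swap_apply_of_ne_of_ne hx.1 hx.2.1, Equiv.swap_apply_of_ne_of_ne hx.2.1 hx.2.2]),
    ← key (Equiv.swap k l * Equiv.swap i k) l i (by simp)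
      (by simp [Equiv.swap_apply_of_ne_of_ne hik hil]) (by
      intro x hx; simp at hx
      simp [Equiv.swap_apply_of_ne_of_ne hx.1 hx.2.1, Equiv.swap_apply_of_ne_of_ne hx.2.1 hx.2.2])]
  ring

lemma four_mul_gMn (hsum : ∀ i, ∑ j, M i j = 0) {i k l m : Fin n} (hik : i ≠ k) (hil : i ≠ l)
    (him : i ≠ m) (hkl : k ≠ l) (hkm : k ≠ m) (hlm : l ≠ m) (hMl : M l = M i) (hMm : M m = M k) :
    ∃ C : Equiv.Perm (Fin n) → ℝ, 4 * gMn n M =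
      ∑ π, (nz (C π + (M i - M k) (π i) + (M i - M k) (π l)) +
        nz (C π + (M i - M k) (π k) + (M i - M k) (π l)) +
        nz (C π + (M i - M k) (π i) + (M i - M k) (π m)) +
        nz (C π + (M i - M k) (π k) + (M i - M k) (π m))) := by
  refine ⟨fun π => ∑ x ∈ ({i, k, l, m} : Finset (Fin n))ᶜ, (M x - M k) (π x), ?_⟩
  have key : ∀ (σ : Equiv.Perm (Fin n)) (p q : Fin n), σ i = p → σ l = q →
      (∀ x, x ∉ ({i, k, l, m} : Finset (Fin n)) → σ x = x) →
      gMn n M = ∑ π : Equiv.Perm (Fin n),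
        nz (∑ x ∈ ({i, k, l, m} : Finset (Fin n))ᶜ, (M x - M k) (π x) +
          (M i - M k) (π p) + (M i - M k) (π q)) := by
    rintro σ _ _ rfl rfl hσ
    rw [gMn_eq_sum_nz σ]
    refine Finset.sum_congr rfl fun π _ => ?_
    rw [sum_diag_eq hsum k _ σ π hσ, Finset.sum_insert (by simp [hik, hil, him]),
      Finset.sum_insert (by simp [hkl, hkm]), Finset.sum_pair hlm, hMl, hMm]
    simp [add_assoc]
  simp only [Finset.sum_add_distrib]
  rw [← key 1 i l rfl rfl (by simp),
    ← key (Equiv.swap i k) k l (by simp) (Equiv.swap_apply_of_ne_of_ne hil.symm hkl.symm) (by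
      intro x hx; simp at hx; exact Equiv.swap_apply_of_ne_of_ne hx.1 hx.2.1),
    ← key (Equiv.swap l m) i m (Equiv.swap_apply_of_ne_of_ne hil him) (by simp) (by
      intro x hx; simp at hx; exact Equiv.swap_apply_of_ne_of_ne hx.2.2.1 hx.2.2.2),
    ← key (Equiv.swap i k * Equiv.swap l m) k m
      (by simp [Equiv.swap_apply_of_ne_of_ne hil him])
      (by simp [Equiv.swap_apply_of_ne_of_ne him.symm hkm.symm]) (by
      intro x hx; simp at hx
      simp [Equiv.swap_apply_of_ne_of_ne hx.1 hx.2.1,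
        Equiv.swap_apply_of_ne_of_ne hx.2.2.1 hx.2.2.2])]
  ring

end Diagonals

section Exceptional

/-- The value of `d` at `x` is taken nowhere else. -/
def IsolatedAt {ι : Type*} (d : ι → ℝ) (x : ι) : Prop := ∀ y, y ≠ x → d y ≠ d x

/-- `d` equals `c` off `{a, b}`, and its values at `a` and `b` are distinct and differ from `c`. -/
def ExceptionalAt {ι : Type*} (d : ι → ℝ) (c : ℝ) (a b : ι) : Prop :=
  a ≠ b ∧ d a ≠ c ∧ d b ≠ c ∧ d a ≠ d b ∧ ∀ p, p ≠ a → p ≠ b → d p = c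

lemma ExceptionalAt.symm {ι : Type*} {d : ι → ℝ} {c : ℝ} {a b : ι} (h : ExceptionalAt d c a b) :
    ExceptionalAt d c b a :=
  ⟨h.1.symm, h.2.2.1, h.2.1, h.2.2.2.1.symm, fun p hb ha => h.2.2.2.2 p ha hb⟩

lemma ExceptionalAt.isolatedAt {ι : Type*} {d : ι → ℝ} {c : ℝ} {a b : ι}
    (h : ExceptionalAt d c a b) : IsolatedAt d a := by
  intro y hy
  by_cases hb : y = b
  · rw [hb]; exact h.2.2.2.1.symm
  · rw [h.2.2.2.2 y hy hb]; exact h.2.1.symm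

variable {n : ℕ}

lemma exists_exceptionalAt [NeZero n] (hn : 8 ≤ n) (d : Fin n → ℝ) (hd : d ≠ 0) (hd0 : d 0 = 0)
    (hsum : ∑ q, d q = 0)
    (hcount : ∑ p, ∑ q, (if d p ≠ d q then 1 else 0) ≤ 4 * (n - 1)) :
    ∃ c a b, ExceptionalAt d c a b := by
  classical
  simp_rw [← Finset.card_filter] at hcount
  obtain ⟨p, hp⟩ : ∃ p, #{q | d p ≠ d q} ≤ 3 := by
    by_contra! h
    have h4 : ∑ p : Fin n, 4 ≤ ∑ p, #{q | d p ≠ d q} := Finset.sum_le_sum fun p _ => h p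
    simp only [Finset.sum_const, Finset.card_univ, Fintype.card_fin, smul_eq_mul] at h4
    omega
  set K : Finset (Fin n) := {q | d p ≠ d q} with hK
  have hmem : ∀ q, q ∈ K ↔ d p ≠ d q := by simp [hK]
  have hcompl : #Kᶜ = n - #K := by simp [Finset.card_compl]
  have hlow : #K * #Kᶜ + #Kᶜ * #K ≤ 4 * (n - 1) := by
    refine le_trans ?_ hcount
    rw [← Finset.sum_add_sum_compl K]
    refine Nat.add_le_add ?_ ?_
    · rw [← smul_eq_mul]
      refine Finset.card_nsmul_le_sum _ _ _ fun x hx => Finset.card_le_card fun q hq => ?_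
      simp only [Finset.mem_compl, hmem, not_not] at hx hq
      simp [← hq, Ne.symm hx]
    · rw [← smul_eq_mul]
      refine Finset.card_nsmul_le_sum _ _ _ fun x hx => Finset.card_le_card fun q hq => ?_
      simp only [Finset.mem_compl, hmem, not_not] at hx hq
      simp [← hx, hq]
  have hK2 : #K ≤ 2 := by
    by_contra h
    have h3 : #K = 3 := by omega
    rw [hcompl, h3] at hlow
    omega
  have hnotconst : ∀ e, (∀ q ∈ K, d q = e) → K.Nonempty → False := by
    rintro e he ⟨q, hq⟩
    have hS : (#K : ℝ) * e + (#Kᶜ : ℝ) * d p = 0 := by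
      rw [← hsum, ← Finset.sum_add_sum_compl K, Finset.sum_congr rfl he,
        Finset.sum_congr rfl (g := fun _ => d p) (s₁ := Kᶜ)]
      · simp
      · intro x hx
        simp only [Finset.mem_compl, hmem, not_not] at hx
        exact hx.symm
    have hKpos : (#K : ℝ) ≠ 0 := by
      have := Finset.card_pos.mpr ⟨q, hq⟩
      positivity
    have hKcpos : (#Kᶜ : ℝ) ≠ 0 := by
      have : 0 < #Kᶜ := by omega
      positivity
    have hne := (hmem q).mp hq
    rw [he q hq] at hne
    by_cases h0 : (0 : Fin n) ∈ K
    · have he0 : e = 0 := by rw [← he 0 h0, hd0]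
      simp [he0, hKcpos] at hS
      exact hne (by rw [hS, he0])
    · have hp0 : d p = 0 := by
        have := (hmem 0).not.mp h0
        rw [not_not.mp this, hd0]
      simp [hp0, hKpos] at hS
      exact hne (by rw [hS, hp0])
  have hKne : K.Nonempty := by
    rw [Finset.nonempty_iff_ne_empty]
    intro hemp
    apply hd
    have hconst : ∀ q, d p = d q := fun q => by
      by_contra h
      have := (hmem q).mpr h
      simp [hemp] at this
    funext q
    rw [← hconst q, hconst 0, hd0]
    rfl
  have hcard : #K = 1 ∨ #K = 2 := by
    have := hKne.card_pos
    omega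
  rcases hcard with h1 | h2
  · obtain ⟨a, ha⟩ := Finset.card_eq_one.mp h1
    exact (hnotconst (d a) (by simp [ha]) hKne).elim
  · obtain ⟨a, b, hab, hKab⟩ := Finset.card_eq_two.mp h2
    refine ⟨d p, a, b, hab, ?_, ?_, ?_, ?_⟩
    · exact ((hmem a).mp (by simp [hKab])).symm
    · exact ((hmem b).mp (by simp [hKab])).symm
    · intro h
      exact hnotconst (d a) (by simp [hKab, h]) hKne
    · intro q hqa hqb
      by_contra h
      have := (hmem q).mpr (Ne.symm h)
      simp [hKab, hqa, hqb] at this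

lemma ExceptionalAt.sub_ne (hn : 8 ≤ n) {u v : Fin n → ℝ} {cu cv cw : ℝ} {a b a' b' : Fin n}
    (hu : ExceptionalAt u cu a b) (hv : ExceptionalAt v cv a b)
    (hw : ExceptionalAt (u - v) cw a' b') : u a - cu ≠ v a - cv := by
  intro h
  obtain ⟨p, hp⟩ : ∃ p, p ∉ ({a, b, a', b'} : Finset (Fin n)) := by
    by_contra! hall
    have h1 : #(Finset.univ : Finset (Fin n)) ≤ #({a, b, a', b'} : Finset (Fin n)) :=
      Finset.card_le_card fun x _ => hall x
    have h2 : #({a, b, a', b'} : Finset (Fin n)) ≤ 4 := Finset.card_le_four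
    simp at h1
    omega
  simp only [Finset.mem_insert, Finset.mem_singleton, not_or] at hp
  obtain ⟨-, -, -, -, hu⟩ := hu
  obtain ⟨-, -, -, -, hv⟩ := hv
  obtain ⟨hab', ha', hb', -, hw⟩ := hw
  have hcw : cw = cu - cv := by
    rw [← hw p hp.2.2.1 hp.2.2.2, Pi.sub_apply, hu p hp.1 hp.2.1, hv p hp.1 hp.2.1]
  have hoff : ∀ q, q ≠ b → (u - v) q = cw := by
    intro q hq
    by_cases hqa : q = a
    · rw [hqa, hcw, Pi.sub_apply]; linarith
    · rw [hcw, Pi.sub_apply, hu q hqa hq, hv q hqa hq]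
  have h1 : a' = b := by by_contra h; exact ha' (hoff _ h)
  have h2 : b' = b := by by_contra h; exact hb' (hoff _ h)
  exact hab' (h1.trans h2.symm)

end Exceptional

section LowerBounds

variable {n : ℕ} {M : Matrix (Fin n) (Fin n) ℝ}

lemma factorial_pred_eq (hn : 8 ≤ n) : (n - 1).factorial = (n - 1) * (n - 2).factorial := by
  obtain ⟨m, rfl⟩ : ∃ m, n = m + 2 := ⟨n - 2, by omega⟩
  exact Nat.factorial_succ m

lemma sum_ne_le (hn : 8 ≤ n) (hsum : ∀ i, ∑ j, M i j = 0)
    (hg : gMn n M ≤ 2 * (n - 1).factorial) {i k : Fin n} (hik : i ≠ k) :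
    ∑ p, ∑ q, (if (M i - M k) p ≠ (M i - M k) q then 1 else 0) ≤ 4 * (n - 1) := by
  obtain ⟨C, hC⟩ := two_mul_gMn hsum hik
  have hle : ∑ π : Equiv.Perm (Fin n),
      (if (M i - M k) (π i) ≠ (M i - M k) (π k) then 1 else 0) ≤ 2 * gMn n M := by
    rw [hC]
    refine Finset.sum_le_sum fun π _ => ?_
    split_ifs with h
    · exact one_le_two_nz _ _ _ h
    · exact Nat.zero_le _
  rw [sum_perm_pair hik (fun p q => (M i - M k) p ≠ (M i - M k) q) (by simp),
    Fintype.card_fin] at hle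
  refine Nat.le_of_mul_le_mul_right (hle.trans ?_) (Nat.factorial_pos (n - 2))
  rw [factorial_pred_eq hn] at hg
  linarith

lemma lt_gMn_of_three_isolated (hn : 8 ≤ n) (hsum : ∀ i, ∑ j, M i j = 0) {i k l : Fin n}
    (hik : i ≠ k) (hil : i ≠ l) (hkl : k ≠ l) {a b c : Fin n} (hab : a ≠ b) (hac : a ≠ c)
    (hbc : b ≠ c) (ha : IsolatedAt (M i - M l) a ∨ IsolatedAt (M k - M l) a)
    (hb : IsolatedAt (M i - M l) b ∨ IsolatedAt (M k - M l) b)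
    (hc : IsolatedAt (M i - M l) c ∨ IsolatedAt (M k - M l) c) :
    2 * (n - 1).factorial < gMn n M := by
  obtain ⟨C, hC⟩ := six_mul_gMn hsum hik hil hkl
  set I : Finset (Fin n) := {i, k, l} with hI
  have hIcard : #I = 3 := Finset.card_eq_three.mpr ⟨i, k, l, hik, hil, hkl, rfl⟩
  have hle : ∑ π : Equiv.Perm (Fin n), 2 * ((if π.symm a ∈ I then 1 else 0) +
      (if π.symm b ∈ I then 1 else 0) + (if π.symm c ∈ I then 1 else 0)) ≤
      6 * gMn n M + ∑ π : Equiv.Perm (Fin n),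
        2 * ((if π.symm a ∈ I ∧ π.symm b ∈ I then 1 else 0) +
        (if π.symm a ∈ I ∧ π.symm c ∈ I then 1 else 0) +
        (if π.symm b ∈ I ∧ π.symm c ∈ I then 1 else 0)) := by
    rw [hC, ← Finset.sum_add_distrib]
    refine Finset.sum_le_sum fun π _ => ?_
    have h1 := π.injective.ne hik
    have h2 := π.injective.ne hil
    have h3 := π.injective.ne hkl
    have key : ∀ x, (IsolatedAt (M i - M l) x ∨ IsolatedAt (M k - M l) x) → π.symm x ∈ I →
        2 ≤ _ := fun x hx hxI => two_le_six_nz (C π) ((M i - M l) (π i)) ((M i - M l) (π k))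
          ((M i - M l) (π l)) ((M k - M l) (π i)) ((M k - M l) (π k)) ((M k - M l) (π l)) (by
      rintro ⟨e1, e2, e3, e4⟩
      simp only [hI, Finset.mem_insert, Finset.mem_singleton, Equiv.symm_apply_eq] at hxI
      rcases hxI with rfl | rfl | rfl <;> rcases hx with hx | hx
      · exact hx _ h1.symm e1.symm
      · exact hx _ h1.symm e3.symm
      · exact hx _ h1 e1
      · exact hx _ h1 e3
      · exact hx _ h2 e2
      · exact hx _ h2 e4)
    have ka := key a ha
    have kb := key b hb
    have kc := key c hc
    by_cases pa : π.symm a ∈ I <;> by_cases pb : π.symm b ∈ I <;> by_cases pc : π.symm c ∈ I <;>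
      simp only [pa, pb, pc, and_true, and_false, if_true, if_false,
        forall_const] at ka kb kc ⊢ <;> omega
  simp only [← Finset.mul_sum, Finset.sum_add_distrib, sum_hit, sum_hit_pair I hab,
    sum_hit_pair I hac, sum_hit_pair I hbc, Finset.offDiag_card, hIcard, Fintype.card_fin] at hle
  rw [factorial_pred_eq hn] at hle ⊢
  obtain ⟨t, rfl⟩ : ∃ t, n = t + 8 := ⟨n - 8, by omega⟩
  simp only [show t + 8 - 1 = t + 7 from rfl] at hle ⊢
  have := Nat.factorial_pos (t + 8 - 2)
  nlinarith

lemma lt_gMn_of_same_exceptional (hn : 8 ≤ n) (hsum : ∀ i, ∑ j, M i j = 0) {i k l : Fin n}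
    (hik : i ≠ k) (hil : i ≠ l) (hkl : k ≠ l) {a b : Fin n} {cu cv : ℝ}
    (hu : ExceptionalAt (M i - M l) cu a b) (hv : ExceptionalAt (M k - M l) cv a b)
    (ha : (M i - M l) a - cu ≠ (M k - M l) a - cv) (hb : (M i - M l) b - cu ≠ (M k - M l) b - cv) :
    2 * (n - 1).factorial < gMn n M := by
  obtain ⟨C, hC⟩ := six_mul_gMn hsum hik hil hkl
  set I : Finset (Fin n) := {i, k, l} with hI
  have hIcard : #I = 3 := Finset.card_eq_three.mpr ⟨i, k, l, hik, hil, hkl, rfl⟩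
  have hle : ∑ π : Equiv.Perm (Fin n), 4 * ((if π.symm a ∈ I then 1 else 0) +
      (if π.symm b ∈ I then 1 else 0)) ≤
      6 * gMn n M + ∑ π : Equiv.Perm (Fin n),
        8 * (if π.symm a ∈ I ∧ π.symm b ∈ I then 1 else 0) := by
    rw [hC, ← Finset.sum_add_distrib]
    refine Finset.sum_le_sum fun π _ => ?_
    have h1 := π.injective.ne hik
    have h2 := π.injective.ne hil
    have h3 := π.injective.ne hkl
    have key : ∀ x y, ExceptionalAt (M i - M l) cu x y → ExceptionalAt (M k - M l) cv x y →
        (M i - M l) x - cu ≠ (M k - M l) x - cv → π.symm x ∈ I → π.symm y ∉ I →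
        4 ≤ _ := fun x y hu hv hx hxI hyI =>
          four_le_six_nz (C π) ((M i - M l) (π i)) ((M i - M l) (π k))
          ((M i - M l) (π l)) ((M k - M l) (π i)) ((M k - M l) (π k)) ((M k - M l) (π l)) cu cv (by
      obtain ⟨-, hux, -, -, hu⟩ := hu
      obtain ⟨-, hvx, -, -, hv⟩ := hv
      simp only [hI, Finset.mem_insert, Finset.mem_singleton, Equiv.symm_apply_eq, not_or]
        at hxI hyI
      obtain ⟨y1, y2, y3⟩ := hyI
      rcases hxI with rfl | rfl | rfl
      · exact Or.inl ⟨hux, hvx, hx, hu _ h1.symm (Ne.symm y2), hu _ h2.symm (Ne.symm y3),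
          hv _ h1.symm (Ne.symm y2), hv _ h2.symm (Ne.symm y3)⟩
      · exact Or.inr (Or.inl ⟨hux, hvx, hx, hu _ h1 (Ne.symm y1), hu _ h3.symm (Ne.symm y3),
          hv _ h1 (Ne.symm y1), hv _ h3.symm (Ne.symm y3)⟩)
      · exact Or.inr (Or.inr ⟨hux, hvx, hx, hu _ h2 (Ne.symm y1), hu _ h3 (Ne.symm y2),
          hv _ h2 (Ne.symm y1), hv _ h3 (Ne.symm y2)⟩))
    have ka := key a b hu hv ha
    have kb := key b a hu.symm hv.symm hb
    by_cases pa : π.symm a ∈ I <;> by_cases pb : π.symm b ∈ I <;>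
      simp only [pa, pb, not_true, not_false_iff, and_true, and_false, if_true, if_false,
        forall_const] at ka kb ⊢ <;> omega
  simp only [← Finset.mul_sum, Finset.sum_add_distrib, sum_hit, sum_hit_pair I hu.1,
    Finset.offDiag_card, hIcard, Fintype.card_fin] at hle
  rw [factorial_pred_eq hn] at hle ⊢
  obtain ⟨t, rfl⟩ : ∃ t, n = t + 8 := ⟨n - 8, by omega⟩
  simp only [show t + 8 - 1 = t + 7 from rfl] at hle ⊢
  have := Nat.factorial_pos (t + 8 - 2)
  nlinarith

lemma lt_gMn_of_two_pairs (hn : 8 ≤ n) (hsum : ∀ i, ∑ j, M i j = 0) {i k l m : Fin n}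
    (hik : i ≠ k) (hil : i ≠ l) (him : i ≠ m) (hkl : k ≠ l) (hkm : k ≠ m) (hlm : l ≠ m)
    (hMl : M l = M i) (hMm : M m = M k) {a b : Fin n} (hab : a ≠ b)
    (ha : IsolatedAt (M i - M k) a) (hb : IsolatedAt (M i - M k) b) :
    2 * (n - 1).factorial < gMn n M := by
  obtain ⟨C, hC⟩ := four_mul_gMn hsum hik hil him hkl hkm hlm hMl hMm
  set I : Finset (Fin n) := {i, k, l, m} with hI
  have hIcard : #I = 4 := by
    rw [hI, Finset.card_insert_of_notMem (by simp [hik, hil, him]),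
      Finset.card_insert_of_notMem (by simp [hkl, hkm]), Finset.card_pair hlm]
  have hle : ∑ π : Equiv.Perm (Fin n), 2 * ((if π.symm a ∈ I then 1 else 0) +
      (if π.symm b ∈ I then 1 else 0)) ≤
      4 * gMn n M + ∑ π : Equiv.Perm (Fin n),
        2 * (if π.symm a ∈ I ∧ π.symm b ∈ I then 1 else 0) := by
    rw [hC, ← Finset.sum_add_distrib]
    refine Finset.sum_le_sum fun π _ => ?_
    have h1 := π.injective.ne hik
    have h2 := π.injective.ne hlm
    have key : ∀ x, IsolatedAt (M i - M k) x → π.symm x ∈ I →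
        2 ≤ _ := fun x hx hxI => two_le_four_nz (C π) ((M i - M k) (π i)) ((M i - M k) (π k))
          ((M i - M k) (π l)) ((M i - M k) (π m)) (by
      rintro ⟨e1, e2⟩
      simp only [hI, Finset.mem_insert, Finset.mem_singleton, Equiv.symm_apply_eq] at hxI
      rcases hxI with rfl | rfl | rfl | rfl
      · exact hx _ h1.symm e1.symm
      · exact hx _ h1 e1
      · exact hx _ h2.symm e2.symm
      · exact hx _ h2 e2)
    have ka := key a ha
    have kb := key b hb
    by_cases pa : π.symm a ∈ I <;> by_cases pb : π.symm b ∈ I <;>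
      simp only [pa, pb, and_true, and_false, if_true, if_false,
        forall_const] at ka kb ⊢ <;> omega
  simp only [← Finset.mul_sum, Finset.sum_add_distrib, sum_hit, sum_hit_pair I hab,
    Finset.offDiag_card, hIcard, Fintype.card_fin] at hle
  rw [factorial_pred_eq hn] at hle ⊢
  obtain ⟨t, rfl⟩ : ∃ t, n = t + 8 := ⟨n - 8, by omega⟩
  simp only [show t + 8 - 1 = t + 7 from rfl] at hle ⊢
  have := Nat.factorial_pos (t + 8 - 2)
  nlinarith

end LowerBounds

lemma exists_three_or_two_pairs {ι β : Type*} [Nonempty ι] (R : ι → β)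
    (h : ¬ ∃ θ, ∀ x y, x ≠ θ → y ≠ θ → R x = R y) :
    (∃ i k l, R i ≠ R k ∧ R i ≠ R l ∧ R k ≠ R l) ∨
      ∃ i k l m, R i ≠ R k ∧ i ≠ l ∧ k ≠ m ∧ R l = R i ∧ R m = R k := by
  by_contra! hcon
  obtain ⟨h3, h4⟩ := hcon
  push Not at h
  obtain ⟨i, k, -, -, hik⟩ := h (Classical.arbitrary ι)
  have hor : ∀ x, R x = R i ∨ R x = R k := by
    intro x
    by_contra! hx
    exact hx.2 (h3 i k x hik hx.1.symm).symm
  have twin : ∀ i k, R i ≠ R k → (∀ x, R x = R i ∨ R x = R k) → ∃ l, i ≠ l ∧ R l = R i := by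
    intro i k hik hor
    obtain ⟨x, y, hx, hy, hxy⟩ := h i
    rcases hor x with h1 | h1
    · exact ⟨x, hx.symm, h1⟩
    · rcases hor y with h2 | h2
      · exact ⟨y, hy.symm, h2⟩
      · exact (hxy (h1.trans h2.symm)).elim
  obtain ⟨l, hil, hl⟩ := twin i k hik hor
  obtain ⟨m, hkm, hm⟩ := twin k i hik.symm fun x => (hor x).symm
  exact h4 i k l m hik hil hkm hl hm

lemma uniform_of_eight_le (n : ℕ) [NeZero n] (hn : 8 ≤ n)
    (M : Matrix (Fin n) (Fin n) ℝ) (hM : IsSpecial n M)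
    (hg : gMn n M ≤ 2 * Nat.factorial (n - 1)) :
    ∃ θ : Fin n, ∀ α β : Fin n, α ≠ θ → β ≠ θ → M α = M β := by
  by_contra hcon
  obtain ⟨-, hcol, -, hsum⟩ := hM
  have hexc : ∀ i k, M i ≠ M k → ∃ c a b, ExceptionalAt (M i - M k) c a b := by
    intro i k hik
    refine exists_exceptionalAt hn _ (sub_ne_zero.mpr hik) (by simp [hcol])
      (by simp [Finset.sum_sub_distrib, hsum])
      (sum_ne_le hn hsum hg (by rintro rfl; exact hik rfl))
  rcases exists_three_or_two_pairs M hcon with ⟨i, k, l, hik, hil, hkl⟩ |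
    ⟨i, k, l, m, hik, hil, hkm, hl, hm⟩
  · have nik : i ≠ k := by rintro rfl; exact hik rfl
    have nil : i ≠ l := by rintro rfl; exact hil rfl
    have nkl : k ≠ l := by rintro rfl; exact hkl rfl
    obtain ⟨cu, a, b, hu⟩ := hexc i l hil
    obtain ⟨cv, a', b', hv⟩ := hexc k l hkl
    obtain ⟨cw, a'', b'', hw⟩ := hexc i k hik
    have hthree : ∀ x, IsolatedAt (M k - M l) x → x = a ∨ x = b := by
      intro x hx
      by_contra! hne
      exact hg.not_gt (lt_gMn_of_three_isolated hn hsum nik nil nkl hu.1 hne.1.symm hne.2.symm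
        (Or.inl hu.isolatedAt) (Or.inl hu.symm.isolatedAt) (Or.inr hx))
    have hv' : ExceptionalAt (M k - M l) cv a b := by
      rcases hthree a' hv.isolatedAt with rfl | rfl <;>
        rcases hthree b' hv.symm.isolatedAt with rfl | rfl
      · exact (hv.1 rfl).elim
      · exact hv
      · exact hv.symm
      · exact (hv.1 rfl).elim
    rw [← sub_sub_sub_cancel_right _ _ (M l)] at hw
    exact hg.not_gt (lt_gMn_of_same_exceptional hn hsum nik nil nkl hu hv'
      (hu.sub_ne hn hv' hw) (hu.symm.sub_ne hn hv'.symm hw))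
  · obtain ⟨c, a, b, hu⟩ := hexc i k hik
    refine hg.not_gt (lt_gMn_of_two_pairs hn hsum (i := i) (k := k) (l := l) (m := m)
      ?_ hil ?_ ?_ hkm ?_ hl hm hu.1 hu.isolatedAt hu.symm.isolatedAt)
    · rintro rfl; exact hik rfl
    · rintro rfl; exact hik hm
    · rintro rfl; exact hik hl.symm
    · rintro rfl; exact hik (hl.symm.trans hm)

lemma uniform_of_three (M : Matrix (Fin 3) (Fin 3) ℝ) (hM : IsSpecial 3 M)
    (hg : gMn 3 M ≤ 2 * Nat.factorial (3 - 1)) :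
    ∃ θ : Fin 3, ∀ α β : Fin 3, α ≠ θ → β ≠ θ → M α = M β := by
  obtain ⟨-, hcol, hrow, hsum⟩ := hM
  have hM2 : ∀ i, M i 2 = - M i 1 := by
    intro i
    have := hsum i
    rw [Fin.sum_univ_three, hcol] at this
    linarith
  have hext : ∀ i k, M i 1 = M k 1 → M i = M k := by
    intro i k h
    funext j
    fin_cases j
    · simp [hcol]
    · exact h
    · simp [hM2, h]
  by_contra hcon
  push Not at hcon
  have hne : ∀ i k θ : Fin 3, i ≠ θ → k ≠ θ → i ≠ k → M i 1 ≠ M k 1 := by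
    intro i k θ hi hk hik h
    obtain ⟨x, y, hx, hy, hxy⟩ := hcon θ
    apply hxy
    have hMik := hext i k h
    have hx' : x = i ∨ x = k := by omega
    have hy' : y = i ∨ y = k := by omega
    rcases hx' with rfl | rfl <;> rcases hy' with rfl | rfl <;> simp [hMik]
  have h1 : M 1 1 ≠ 0 := by
    rw [← hrow 1]; exact hne 1 0 2 (by decide) (by decide) (by decide)
  have h2 : M 2 1 ≠ 0 := by
    rw [← hrow 1]; exact hne 2 0 1 (by decide) (by decide) (by decide)
  have h3 : M 1 1 - M 2 1 ≠ 0 := sub_ne_zero.mpr (hne 1 2 0 (by decide) (by decide) (by decide))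
  have hall : ∀ π : Equiv.Perm (Fin 3), ∑ i, M i (π i) ≠ 0 := by
    intro π
    rw [Fin.sum_univ_three, hrow]
    have h12 : π 1 ≠ π 2 := π.injective.ne (by decide)
    generalize π 1 = p at *
    generalize π 2 = q at *
    intro h
    fin_cases p <;> fin_cases q <;> simp [hcol, hM2] at h h12 <;> first
      | exact h1 h
      | exact h2 h
      | exact h3 (by linarith)
  have hcard : gMn 3 M = 6 := by
    unfold gMn gM
    rw [Finset.filter_true_of_mem fun π _ => hall π, Finset.card_univ, Fintype.card_perm]
    rfl
  rw [hcard] at hg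
  norm_num [Nat.factorial] at hg

/-- Lemma 7: for n ≥ 8 or n = 3, a special matrix M with
g_M(n) ≤ 2(n−1)! is θ-uniform for some θ, i.e. all rows other than R_θ coincide. -/
theorem statement9 (n : ℕ) [NeZero n] (hn : 8 ≤ n ∨ n = 3)
    (M : Matrix (Fin n) (Fin n) ℝ) (hM : IsSpecial n M)
    (hg : gMn n M ≤ 2 * Nat.factorial (n - 1)) :
    ∃ θ : Fin n, ∀ α β : Fin n, α ≠ θ → β ≠ θ → M α = M β := by
  rcases hn with hn | rfl
  · exact uniform_of_eight_le n hn M hM hg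
  · exact uniform_of_three M hM hg
end

section
/- Let n ≥ 8 or n = 3, and let M be a special real n×n matrix. Then g_M(n) = 2(n−1)! if and only if M ∈ M_1(n) or M ∈ M_2(n). -/
open Finset

/-- M is the (x,p₁,p₂)-matrix for some x ≠ 0 and distinct p₁, p₂ ∈ {2,...,n}:
every row other than the first equals (0,...,x,...,−x,...,0) with x in column p₁ and
−x in column p₂, and the first row is zero. -/
def MemM1 (n : ℕ) [NeZero n] (M : Matrix (Fin n) (Fin n) ℝ) : Prop :=
  ∃ x : ℝ, x ≠ 0 ∧ ∃ p₁ p₂ : Fin n, p₁ ≠ 0 ∧ p₂ ≠ 0 ∧ p₁ ≠ p₂ ∧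
    ∀ i j, M i j = if i ≠ 0 ∧ j = p₁ then x else if i ≠ 0 ∧ j = p₂ then -x else 0

/-- M is the (x,q₁,q₂,τ)-matrix for some x ≠ 0 and q₁, q₂, τ ∈ {2,...,n}, q₁ ≠ q₂:
the single entry (τ,q₁) equals x, the entry (τ,q₂) equals −x, all others vanish. -/
def MemM2 (n : ℕ) [NeZero n] (M : Matrix (Fin n) (Fin n) ℝ) : Prop :=
  ∃ x : ℝ, x ≠ 0 ∧ ∃ q₁ q₂ τ : Fin n, q₁ ≠ 0 ∧ q₂ ≠ 0 ∧ τ ≠ 0 ∧ q₁ ≠ q₂ ∧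
    ∀ i j, M i j = if i = τ ∧ j = q₁ then x else if i = τ ∧ j = q₂ then -x else 0

theorem exists_disjoint_ne {α β : Type*} [Fintype α] (hcard : 4 ≤ Fintype.card α) (u : α → β)
    (h : ∀ t, ∃ a b, a ≠ t ∧ b ≠ t ∧ u a ≠ u b) :
    ∃ p q p' q', p ≠ p' ∧ p ≠ q' ∧ q ≠ p' ∧ q ≠ q' ∧ u p ≠ u q ∧ u p' ≠ u q' := by
  classical
  have hfresh : ∀ s : Finset α, s.card ≤ 3 → ∃ x, x ∉ s := by
    intro s hs
    by_contra! hall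
    have : s = univ := Finset.eq_univ_iff_forall.2 hall
    rw [this, Finset.card_univ] at hs
    omega
  obtain ⟨x₀, -⟩ := hfresh ∅ (by simp)
  obtain ⟨i, k, -, -, hik⟩ := h x₀
  obtain ⟨s, hs⟩ := hfresh {i, k} (Finset.card_le_two.trans (by norm_num))
  obtain ⟨t, ht⟩ := hfresh {i, k, s} Finset.card_le_three
  simp only [Finset.mem_insert, Finset.mem_singleton, not_or] at hs ht
  by_contra! hno
  have hoff : ∀ x, x = i ∨ x = k ∨ u x = u s := fun x => by
    by_contra! hx
    exact hx.2.2 (hno i k x s hx.1.symm (Ne.symm hs.1) hx.2.1.symm (Ne.symm hs.2) hik)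
  obtain ⟨a, b, hai, hbi, hab⟩ := h i
  obtain ⟨c, d, hck, hdk, hcd⟩ := h k
  have hks : u k ≠ u s := by
    have h1 := hoff a
    have h2 := hoff b
    have h3 := hoff t
    clear hno hfresh h hoff; grind
  have hit : u i ≠ u t := by
    have h1 := hoff c
    have h2 := hoff d
    have h3 := hoff t
    clear hno hfresh h hoff; grind
  have hki : k ≠ i := fun h => hik (h ▸ rfl)
  exact hit (hno k s i t hki (Ne.symm ht.2.1) hs.1 (Ne.symm ht.2.2) hks)

theorem card_mul_sum_perm_apply {α : Type*} [Fintype α] [DecidableEq α] (i : α) (F : α → ℕ) :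
    Fintype.card α * ∑ π : Equiv.Perm α, F (π i) = (Fintype.card α).factorial * ∑ a, F a := by
  have h : ∀ j, ∑ π : Equiv.Perm α, F (π j) = ∑ π : Equiv.Perm α, F (π i) := fun j =>
    Fintype.sum_equiv (Equiv.mulRight (Equiv.swap i j)) _ _ (by simp)
  calc _ = ∑ j, ∑ π : Equiv.Perm α, F (π j) := by simp [h]
    _ = ∑ π : Equiv.Perm α, ∑ j, F (π j) := Finset.sum_comm
    _ = _ := by simp [Equiv.sum_comp, Fintype.card_perm]

/-- The sum of `F a b c d` over all quadruples of distinct elements. -/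
def sumQuad {α : Type*} [Fintype α] [DecidableEq α] (F : α → α → α → α → ℕ) : ℕ :=
  ∑ x ∈ (univ : Finset α).offDiag, ∑ y ∈ ({x.1, x.2}ᶜ : Finset α).offDiag, F x.1 x.2 y.1 y.2

theorem sumQuad_comp_perm {α : Type*} [Fintype α] [DecidableEq α] (F : α → α → α → α → ℕ)
    (π : Equiv.Perm α) : sumQuad (fun a b c d => F (π a) (π b) (π c) (π d)) = sumQuad F := by
  unfold sumQuad
  refine Finset.sum_equiv (Equiv.prodCongr π π) (by simp) fun x _ => ?_
  exact Finset.sum_equiv (Equiv.prodCongr π π) (by simp) (by simp)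

theorem exists_perm_quad {α : Type*} [Finite α] {a b c d a' b' c' d' : α}
    (h : [a, b, c, d].Nodup) (h' : [a', b', c', d'].Nodup) :
    ∃ σ : Equiv.Perm α, σ a = a' ∧ σ b = b' ∧ σ c = c' ∧ σ d = d' := by
  have hf : Function.Injective ![a, b, c, d] := by
    rw [← List.nodup_ofFn]; simpa [List.ofFn_succ] using h
  have hg : Function.Injective ![a', b', c', d'] := by
    rw [← List.nodup_ofFn]; simpa [List.ofFn_succ] using h'
  obtain ⟨σ, hσ⟩ := Equiv.Perm.exists_extending_pair _ _ hf hg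
  exact ⟨σ, hσ 0, hσ 1, hσ 2, hσ 3⟩

theorem sumQuad_one_mul_sum_perm {α : Type*} [Fintype α] [DecidableEq α] {i k i' k' : α}
    (h : [i, k, i', k'].Nodup) (F : α → α → α → α → ℕ) :
    sumQuad (fun _ _ _ _ : α => 1) * ∑ π : Equiv.Perm α, F (π i) (π k) (π i') (π k') =
      (Fintype.card α).factorial * sumQuad F := by
  have hinv : ∀ a b c d, [a, b, c, d].Nodup → ∑ π : Equiv.Perm α, F (π a) (π b) (π c) (π d) =
      ∑ π : Equiv.Perm α, F (π i) (π k) (π i') (π k') := by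
    intro a b c d hq
    obtain ⟨σ, rfl, rfl, rfl, rfl⟩ := exists_perm_quad h hq
    exact Fintype.sum_equiv (Equiv.mulRight σ) _ _ (by simp)
  calc _ = sumQuad fun a b c d => ∑ π : Equiv.Perm α, F (π a) (π b) (π c) (π d) := by
        simp only [sumQuad, Finset.sum_mul, one_mul]
        refine Finset.sum_congr rfl fun x hx => Finset.sum_congr rfl fun y hy => ?_
        refine (hinv _ _ _ _ ?_).symm
        simp at hx hy ⊢
        grind
    _ = ∑ π : Equiv.Perm α, sumQuad fun a b c d => F (π a) (π b) (π c) (π d) := by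
        simp only [sumQuad]
        rw [Finset.sum_comm]
        exact Finset.sum_congr rfl fun x _ => Finset.sum_comm
    _ = _ := by simp [sumQuad_comp_perm, Fintype.card_perm]

theorem card_offDiag_compl_pair {α : Type*} [Fintype α] [DecidableEq α] {a b : α} (hab : a ≠ b) :
    (({a, b}ᶜ : Finset α).offDiag).card = (Fintype.card α - 2) * (Fintype.card α - 3) := by
  rw [Finset.offDiag_card, Finset.card_compl, Finset.card_pair hab, ← Nat.mul_sub_one]
  rfl

theorem sumQuad_one {α : Type*} [Fintype α] [DecidableEq α] :
    sumQuad (fun _ _ _ _ : α => 1) = Fintype.card α * (Fintype.card α - 1) *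
      ((Fintype.card α - 2) * (Fintype.card α - 3)) := by
  unfold sumQuad
  rw [Finset.sum_congr rfl (g := fun _ => (Fintype.card α - 2) * (Fintype.card α - 3))]
  · simp [Finset.offDiag_card, Nat.mul_sub_one]
  · intro x hx
    rw [← Finset.card_eq_sum_ones, card_offDiag_compl_pair (by simpa using hx)]

theorem two_le_card_filter_ne {α β : Type*} [DecidableEq α] [DecidableEq β] {w : α → β}
    {p q p' q' : α} (h1 : p ≠ p') (h2 : p ≠ q') (h3 : q ≠ p') (h4 : q ≠ q')
    (hpq : w p ≠ w q) (hpq' : w p' ≠ w q') (v : β) :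
    2 ≤ (({p, q, p', q'} : Finset α).filter (fun y => w y ≠ v)).card := by
  obtain ⟨a, ha, hav⟩ : ∃ a, (a = p ∨ a = q) ∧ w a ≠ v := by grind
  obtain ⟨b, hb, hbv⟩ : ∃ b, (b = p' ∨ b = q') ∧ w b ≠ v := by grind
  have hab : a ≠ b := by grind
  rw [← Finset.card_pair hab]
  refine Finset.card_le_card ?_
  grind

theorem le_card_ne_pairs {α β : Type*} [Fintype α] [DecidableEq α] [DecidableEq β] {w : α → β}
    {p q p' q' : α} (h1 : p ≠ p') (h2 : p ≠ q') (h3 : q ≠ p') (h4 : q ≠ q')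
    (hpq : w p ≠ w q) (hpq' : w p' ≠ w q') :
    2 * Fintype.card α + 2 * (Fintype.card α - 4) ≤
      (((univ : Finset α).offDiag).filter (fun x => w x.1 ≠ w x.2)).card := by
  set Q : Finset α := {p, q, p', q'} with hQ
  have hQc : Q.card = 4 := by
    rw [hQ]
    repeat rw [Finset.card_insert_of_notMem]
    all_goals grind
  have key := two_le_card_filter_ne h1 h2 h3 h4 hpq hpq'
  rw [← hQ] at key
  have hA : 2 * Fintype.card α ≤
      ∑ x : α, (Q.filter (fun y => w y ≠ w x)).card := by
    calc _ = ∑ _x : α, 2 := by simp [mul_comm]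
      _ ≤ _ := Finset.sum_le_sum fun x _ => key _
  have hB : 2 * (Fintype.card α - 4) ≤ ∑ x ∈ Qᶜ, (Q.filter (fun y => w y ≠ w x)).card := by
    calc _ = ∑ _x ∈ Qᶜ, 2 := by simp [mul_comm, Finset.card_compl, hQc]
      _ ≤ _ := Finset.sum_le_sum fun x _ => key _
  refine (add_le_add hA hB).trans ?_
  rw [← Finset.card_sigma, ← Finset.card_sigma, ← Finset.card_disjSum]
  refine Finset.card_le_card_of_injOn
    (Sum.elim (fun z => (z.1, z.2)) (fun z => (z.2, z.1))) ?_ ?_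
  · rintro (⟨a, b⟩ | ⟨a, b⟩) h <;> simp at h ⊢ <;> grind
  · rintro (⟨a, b⟩ | ⟨a, b⟩) h (⟨c, d⟩ | ⟨c, d⟩) h' heq <;> simp at h h' heq ⊢ <;> grind

theorem le_card_ne_pairs_compl {α β : Type*} [Fintype α] [DecidableEq α] [DecidableEq β]
    {w : α → β} {a b p q : α} (hab : a ≠ b) (hp : p ≠ a ∧ p ≠ b) (hq : q ≠ a ∧ q ≠ b)
    (hpq : w p ≠ w q) :
    Fintype.card α - 2 ≤ ((({a, b}ᶜ : Finset α).offDiag).filter (fun y => w y.1 ≠ w y.2)).card := by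
  rw [← Finset.card_pair hab, ← Finset.card_compl]
  refine Finset.card_le_card_of_injOn (fun c => (c, if w c = w p then q else p)) ?_ ?_
  · intro c hc
    simp at hc ⊢
    grind
  · intro c _ d _ h
    simp at h
    exact h.1

theorem four_mul_lt_sumQuad {α β : Type*} [Fintype α] [DecidableEq α] [DecidableEq β]
    (hα : 8 ≤ Fintype.card α) {w w' : α → β}
    (hw : ∃ p q p' q', p ≠ p' ∧ p ≠ q' ∧ q ≠ p' ∧ q ≠ q' ∧ w p ≠ w q ∧ w p' ≠ w q')
    (hw' : ∃ p q p' q', p ≠ p' ∧ p ≠ q' ∧ q ≠ p' ∧ q ≠ q' ∧ w' p ≠ w' q ∧ w' p' ≠ w' q') :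
    4 * (Fintype.card α - 1) * ((Fintype.card α - 2) * (Fintype.card α - 3)) <
      sumQuad fun a b c d : α => if w a ≠ w b ∨ w' c ≠ w' d then 1 else 0 := by
  obtain ⟨p, q, p', q', h1, h2, h3, h4, hpq, hpq'⟩ := hw
  have hS := le_card_ne_pairs h1 h2 h3 h4 hpq hpq'
  clear h1 h2 h3 h4 hpq hpq'
  obtain ⟨p, q, p', q', h1, h2, h3, h4, hpq, hpq'⟩ := hw'
  set E : Finset (α × α) := ({p, q} ×ˢ {p', q'}) ∪ ({p', q'} ×ˢ {p, q}) with hE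
  have hEcard : E.card ≤ 8 := by
    refine (Finset.card_union_le _ _).trans ?_
    rw [Finset.card_product, Finset.card_product]
    have h5 : ({p, q} : Finset α).card ≤ 2 := Finset.card_le_two
    have h6 : ({p', q'} : Finset α).card ≤ 2 := Finset.card_le_two
    nlinarith
  set n := Fintype.card α with hn
  obtain ⟨m, hm⟩ : ∃ m, n = m + 8 := ⟨n - 8, by omega⟩
  have hpt : ∀ x ∈ (univ : Finset α).offDiag,
      (m + 6) + (m + 6) * (m + 4) * (if w x.1 ≠ w x.2 then 1 else 0) ≤
      (∑ y ∈ ({x.1, x.2}ᶜ : Finset α).offDiag,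
        if w x.1 ≠ w x.2 ∨ w' y.1 ≠ w' y.2 then 1 else 0) +
        (m + 6) * (if x ∈ E then 1 else 0) := by
    rintro ⟨a, b⟩ hx
    have hab : a ≠ b := by simpa using hx
    by_cases hwab : w a ≠ w b
    · have hc := card_offDiag_compl_pair hab
      rw [← hn, hm] at hc
      simp only [hwab, ne_eq, not_false_eq_true, true_or, if_true, ← Finset.card_eq_sum_ones, hc]
      have : (m + 8 - 2) * (m + 8 - 3) = (m + 6) * (m + 5) := rfl
      rw [this]
      exact (show m + 6 + (m + 6) * (m + 4) * 1 = (m + 6) * (m + 5) by ring).le.trans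
        (Nat.le_add_right _ _)
    · by_cases hxE : (a, b) ∈ E
      · simp [hwab, hxE]
      · have hedge : ∃ r s, (r ≠ a ∧ r ≠ b) ∧ (s ≠ a ∧ s ≠ b) ∧ w' r ≠ w' s := by
          simp only [hE, Finset.mem_union, Finset.mem_product, Finset.mem_insert,
            Finset.mem_singleton] at hxE
          by_cases hp : (p ≠ a ∧ p ≠ b) ∧ (q ≠ a ∧ q ≠ b)
          · exact ⟨p, q, hp.1, hp.2, hpq⟩
          · refine ⟨p', q', ?_, ?_, hpq'⟩ <;> grind
        obtain ⟨r, s, hr, hs, hrs⟩ := hedge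
        have hc := le_card_ne_pairs_compl hab hr hs hrs
        rw [← hn, hm, Finset.card_filter] at hc
        simp only [hwab, hxE, false_or, if_false, mul_zero, add_zero]
        exact hc
  have hsum := Finset.sum_le_sum hpt
  simp only [Finset.sum_add_distrib, ← Finset.mul_sum, ← Finset.card_filter, Finset.sum_const,
    Finset.offDiag_card, Finset.card_univ, ← hn, hm, smul_eq_mul] at hsum
  have hE' : (univ.offDiag.filter (fun x => x ∈ E)).card ≤ 8 :=
    (Finset.card_le_card (fun x hx => (Finset.mem_filter.1 hx).2)).trans hEcard
  have hcast : (m + 8) * (m + 8) - (m + 8) = (m + 8) * (m + 7) := by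
    rw [← Nat.mul_sub_one]; rfl
  rw [hcast] at hsum
  rw [hm] at hS ⊢
  change 4 * (m + 7) * ((m + 6) * (m + 5)) < sumQuad _
  have hquad : (sumQuad fun a b c d : α => if w a ≠ w b ∨ w' c ≠ w' d then 1 else 0) =
      ∑ x ∈ (univ : Finset α).offDiag, (({x.1, x.2}ᶜ : Finset α).offDiag.filter
        (fun y => w x.1 ≠ w x.2 ∨ w' y.1 ≠ w' y.2)).card := by
    simp only [sumQuad, Finset.card_filter]
  rw [← hquad] at hsum
  have hS' : 2 * (m + 8) + 2 * (m + 4) ≤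
      (univ.offDiag.filter (fun x : α × α => w x.1 ≠ w x.2)).card := hS
  have h5 := Nat.mul_le_mul_left ((m + 6) * (m + 4)) hS'
  have h6 := Nat.mul_le_mul_left (m + 6) hE'
  nlinarith

theorem sum_apply_mul_swap {α : Type*} [Fintype α] [DecidableEq α] (M : Matrix α α ℝ) {i k : α}
    (hik : i ≠ k) (π : Equiv.Perm α) :
    ∑ j, M j ((π * Equiv.swap i k) j) = ∑ j, M j (π j) -
      ((M i (π i) - M k (π i)) - (M i (π k) - M k (π k))) := by
  have h : ∑ j, (M j (π j) - M j ((π * Equiv.swap i k) j)) =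
      (M i (π i) - M i (π k)) + (M k (π k) - M k (π i)) := by
    rw [Fintype.sum_eq_add i k hik]
    · simp
    · rintro x ⟨hx, hx'⟩
      simp [Equiv.swap_apply_of_ne_of_ne hx hx']
  rw [Finset.sum_sub_distrib] at h
  linarith

open scoped Classical in
theorem sum_ite_le_two_mul_gMn {n : ℕ} (M : Matrix (Fin n) (Fin n) ℝ) {i k i' k' : Fin n}
    (h : [i, k, i', k'].Nodup) :
    (∑ π : Equiv.Perm (Fin n), if M i (π i) - M k (π i) ≠ M i (π k) - M k (π k) ∨
      M i' (π i') - M k' (π i') ≠ M i' (π k') - M k' (π k') then 1 else 0) ≤ 2 * gMn n M := by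
  set N : Equiv.Perm (Fin n) → ℕ := fun π => if ∑ j, M j (π j) ≠ 0 then 1 else 0 with hN
  have hg : gMn n M = ∑ π, N π := by rw [gMn, gM, Finset.card_filter]
  have hσ : ∀ σ, gMn n M = ∑ π, N (π * σ) := fun σ => by
    rw [hg]
    exact (Equiv.sum_comp (Equiv.mulRight σ) N).symm
  have hik : i ≠ k := by simp at h; grind
  have hik' : i' ≠ k' := by simp at h; grind
  set s := Equiv.swap i k
  set t := Equiv.swap i' k' with ht
  have hsum : 2 * (∑ π : Equiv.Perm (Fin n), if M i (π i) - M k (π i) ≠ M i (π k) - M k (π k) ∨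
      M i' (π i') - M k' (π i') ≠ M i' (π k') - M k' (π k') then 1 else 0) ≤
      ∑ π, (N π + N (π * s) + N (π * t) + N (π * t * s)) := by
    rw [Finset.mul_sum]
    refine Finset.sum_le_sum fun π _ => ?_
    have e1 := sum_apply_mul_swap M hik π
    have e2 := sum_apply_mul_swap M hik' π
    have e3 := sum_apply_mul_swap M hik (π * t)
    have hti : (π * t) i = π i := by
      simp only [List.nodup_cons, List.mem_cons] at h
      rw [Equiv.Perm.mul_apply, ht, Equiv.swap_apply_of_ne_of_ne] <;> grind
    have htk : (π * t) k = π k := by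
      simp only [List.nodup_cons, List.mem_cons] at h
      rw [Equiv.Perm.mul_apply, ht, Equiv.swap_apply_of_ne_of_ne] <;> grind
    rw [e2, hti, htk] at e3
    simp only [hN]
    rw [e1, e2, e3]
    generalize ∑ j, M j (π j) = f
    generalize hA : M i (π i) - M k (π i) = a
    generalize hB : M i (π k) - M k (π k) = b
    generalize hC : M i' (π i') - M k' (π i') = c
    generalize hD : M i' (π k') - M k' (π k') = d
    clear * -
    grind
  rw [Finset.sum_add_distrib, Finset.sum_add_distrib, Finset.sum_add_distrib, ← hg, ← hσ, ← hσ]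
    at hsum
  have h4 : ∑ π, N (π * t * s) = gMn n M := by
    simp only [mul_assoc]
    rw [← hσ]
  omega

theorem two_mul_factorial_lt_gMn {n : ℕ} (hn : 8 ≤ n) (M : Matrix (Fin n) (Fin n) ℝ)
    {i k i' k' : Fin n} (h : [i, k, i', k'].Nodup)
    (hw : ∃ p q p' q', p ≠ p' ∧ p ≠ q' ∧ q ≠ p' ∧ q ≠ q' ∧
      M i p - M k p ≠ M i q - M k q ∧ M i p' - M k p' ≠ M i q' - M k q')
    (hw' : ∃ p q p' q', p ≠ p' ∧ p ≠ q' ∧ q ≠ p' ∧ q ≠ q' ∧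
      M i' p - M k' p ≠ M i' q - M k' q ∧ M i' p' - M k' p' ≠ M i' q' - M k' q') :
    2 * (n - 1).factorial < gMn n M := by
  classical
  have h1 := four_mul_lt_sumQuad (α := Fin n) (by simpa using hn) hw hw'
  have h2 := sum_ite_le_two_mul_gMn M h
  have h3 := sumQuad_one_mul_sum_perm h (fun a b c d : Fin n =>
    if M i a - M k a ≠ M i b - M k b ∨ M i' c - M k' c ≠ M i' d - M k' d then 1 else 0)
  simp only [sumQuad_one, Fintype.card_fin] at h1 h3
  obtain ⟨m, rfl⟩ : ∃ m, n = m + 8 := ⟨n - 8, by omega⟩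
  rw [show (m + 8).factorial = (m + 8) * (m + 7).factorial from Nat.factorial_succ _] at h3
  change 2 * (m + 7).factorial < _
  have hP : 0 < (m + 8) * (m + 7) * ((m + 6) * (m + 5)) := by positivity
  change 4 * (m + 7) * ((m + 6) * (m + 5)) < _ at h1
  change (m + 8) * (m + 7) * ((m + 6) * (m + 5)) * _ = _ at h3
  have h5 : 0 < (m + 8) * (m + 7).factorial := by positivity
  have h6 := Nat.mul_lt_mul_of_pos_left h1 h5
  have h7 := Nat.mul_le_mul_left ((m + 8) * (m + 7) * ((m + 6) * (m + 5))) h2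
  refine lt_of_mul_lt_mul_left (a := 2 * ((m + 8) * (m + 7) * ((m + 6) * (m + 5)))) ?_ (by positivity)
  calc _ = (m + 8) * (m + 7).factorial * (4 * (m + 7) * ((m + 6) * (m + 5))) := by ring
    _ < _ := h6
    _ = _ := h3.symm
    _ ≤ _ := h7
    _ = _ := by ring

open scoped Classical in
theorem gMn_eq_card_mul_factorial {n : ℕ} [NeZero n] {M : Matrix (Fin n) (Fin n) ℝ} {τ : Fin n}
    {r : Fin n → ℝ} (hr : ∑ j, r j = 0) (h : ∀ i, i ≠ τ → ∀ j, M i j = r j) :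
    gMn n M = (univ.filter fun j => M τ j ≠ r j).card * (n - 1).factorial := by
  have hf : ∀ π : Equiv.Perm (Fin n), ∑ i, M i (π i) = M τ (π τ) - r (π τ) := by
    intro π
    have h1 : ∑ i, (M i (π i) - r (π i)) = M τ (π τ) - r (π τ) :=
      Fintype.sum_eq_single τ fun i hi => by rw [h i hi, sub_self]
    rwa [Finset.sum_sub_distrib, Equiv.sum_comp π r, hr, sub_zero] at h1
  have hc := card_mul_sum_perm_apply τ (fun j : Fin n => if M τ j ≠ r j then 1 else 0)
  have hg : gMn n M = ∑ π : Equiv.Perm (Fin n), if M τ (π τ) ≠ r (π τ) then 1 else 0 := by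
    rw [gMn, gM, Finset.card_filter]
    simp only [hf, sub_ne_zero]
  rw [← hg, ← Finset.card_filter, Fintype.card_fin,
    ← Nat.mul_factorial_pred (NeZero.ne n), mul_assoc] at hc
  rw [Nat.eq_of_mul_eq_mul_left (NeZero.pos n) hc, mul_comm]

theorem gMn_of_memM1 {n : ℕ} [NeZero n] {M : Matrix (Fin n) (Fin n) ℝ} (hM : MemM1 n M) :
    gMn n M = 2 * (n - 1).factorial := by
  classical
  obtain ⟨x, hx, p, q, hp, hq, hpq, h⟩ := hM
  rw [gMn_eq_card_mul_factorial (τ := 0)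
    (r := fun j => if j = p then x else if j = q then -x else 0)]
  · congr 1
    rw [← Finset.card_pair hpq]
    congr 1
    ext j
    simp only [h, Finset.mem_filter, Finset.mem_univ, Finset.mem_insert, Finset.mem_singleton]
    grind
  · rw [Fintype.sum_eq_add p q hpq]
    · simp [hpq.symm]
    · rintro j ⟨h1, h2⟩
      simp [h1, h2]
  · intro i hi j
    simp [h, hi]

theorem gMn_of_memM2 {n : ℕ} [NeZero n] {M : Matrix (Fin n) (Fin n) ℝ} (hM : MemM2 n M) :
    gMn n M = 2 * (n - 1).factorial := by
  classical
  obtain ⟨x, hx, p, q, τ, hp, hq, -, hpq, h⟩ := hM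
  rw [gMn_eq_card_mul_factorial (τ := τ) (r := 0) (by simp)]
  · congr 1
    rw [← Finset.card_pair hpq]
    congr 1
    ext j
    simp only [h, Finset.mem_filter, Finset.mem_univ, Finset.mem_insert, Finset.mem_singleton,
      Pi.zero_apply]
    grind
  · intro i hi j
    simp [h, hi]

theorem memM1_or_memM2_of_gMn_eq {n : ℕ} [NeZero n] (hn : 2 ≤ n) {M : Matrix (Fin n) (Fin n) ℝ}
    (hM : IsSpecial n M) {τ : Fin n} (hτ : ∀ a b, a ≠ τ → b ≠ τ → M a = M b)
    (hg : gMn n M = 2 * (n - 1).factorial) : MemM1 n M ∨ MemM2 n M := by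
  classical
  obtain ⟨-, hcol, hrow, hsum⟩ := hM
  have : Nontrivial (Fin n) := Fin.nontrivial_iff_two_le.2 hn
  obtain ⟨s, hs⟩ := exists_ne τ
  have hrows : ∀ i, i ≠ τ → ∀ j, M i j = M s j := fun i hi j => congrFun (hτ i s hi hs) j
  rw [gMn_eq_card_mul_factorial (hsum s) hrows] at hg
  have hcard := Nat.eq_of_mul_eq_mul_right (Nat.factorial_pos _) hg
  obtain ⟨p, q, hpq, hset⟩ := Finset.card_eq_two.1 hcard
  have hmem : ∀ j, M τ j ≠ M s j ↔ j = p ∨ j = q := fun j => by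
    simpa using Finset.ext_iff.1 hset j
  have hp : p ≠ 0 := fun h => (hmem p).2 (Or.inl rfl) (by rw [h, hcol, hcol])
  have hq : q ≠ 0 := fun h => (hmem q).2 (Or.inr rfl) (by rw [h, hcol, hcol])
  have hdiff : (M τ p - M s p) + (M τ q - M s q) = 0 := by
    rw [← Fintype.sum_eq_add (f := fun j => M τ j - M s j) p q hpq, Finset.sum_sub_distrib,
      hsum, hsum, sub_zero]
    rintro j ⟨h1, h2⟩
    have := (hmem j).not.2 (by tauto)
    rw [sub_eq_zero]
    exact not_not.1 this
  have hpne := (hmem p).2 (Or.inl rfl)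
  by_cases h0 : τ = 0
  · subst h0
    left
    simp only [hrow] at hmem hdiff hpne
    refine ⟨M s p, hpne.symm, p, q, hp, hq, hpq, fun i j => ?_⟩
    have hj := hmem j
    by_cases hi : i = 0
    · simp [hi, hrow]
    · rw [hrows i hi]
      grind
  · right
    have hs0 : ∀ j, M s j = 0 := fun j => by rw [← hrows 0 (Ne.symm h0), hrow]
    simp only [hs0] at hmem hdiff hpne hrows
    refine ⟨M τ p, hpne, p, q, τ, hp, hq, h0, hpq, fun i j => ?_⟩
    have hj := hmem j
    by_cases hi : i = τ
    · subst hi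
      grind
    · simp [hi, hrows i hi]

theorem exists_ne_off_of_sum_eq_zero {n : ℕ} [NeZero n] {w : Fin n → ℝ} (h0 : w 0 = 0)
    (hsum : ∑ j, w j = 0) (hw : w ≠ 0) (t : Fin n) : ∃ a b, a ≠ t ∧ b ≠ t ∧ w a ≠ w b := by
  obtain ⟨x, hx⟩ := Function.ne_iff.1 hw
  obtain ⟨p, -, hp⟩ := Finset.exists_pos_of_sum_zero_of_exists_nonzero w hsum
    ⟨x, Finset.mem_univ x, hx⟩
  obtain ⟨q, -, hq⟩ := Finset.exists_pos_of_sum_zero_of_exists_nonzero (fun j => -w j)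
    (by simp [hsum]) ⟨x, Finset.mem_univ x, by simpa using hx⟩
  by_cases hpt : p = t
  · exact ⟨0, q, by grind, by grind, by grind⟩
  · by_cases hqt : q = t
    · exact ⟨0, p, by grind, by grind, by grind⟩
    · exact ⟨p, q, hpt, hqt, by grind⟩

theorem gMn_three_eq_six {M : Matrix (Fin 3) (Fin 3) ℝ} (hM : IsSpecial 3 M)
    (hne : ∀ τ, ∃ a b, a ≠ τ ∧ b ≠ τ ∧ M a ≠ M b) : gMn 3 M = 6 := by
  classical
  obtain ⟨-, hcol, hrow, hsum⟩ := hM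
  have hneg : ∀ i, M i 2 = -M i 1 := fun i => by
    have := hsum i
    rw [Fin.sum_univ_three, hcol] at this
    linarith
  have hinj : ∀ a b, a ≠ b → M a 1 ≠ M b 1 := by
    have hrows : ∀ a b, M a 1 = M b 1 → M a = M b := by
      intro a b hab
      ext j
      fin_cases j <;> simp [hcol, hneg, hab]
    have hrows' : ∀ a b, a ≠ b → M a ≠ M b := by
      intro a b hab heq
      have hthird : ∀ a b : Fin 3, a ≠ b → ∃ τ, ∀ x, x ≠ τ → x = a ∨ x = b := by decide
      obtain ⟨τ, hτ⟩ := hthird a b hab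
      obtain ⟨c, d, hc, hd, hcd⟩ := hne τ
      rcases hτ c hc with rfl | rfl <;> rcases hτ d hd with rfl | rfl <;> grind
    exact fun a b hab h => hrows' a b hab (hrows a b h)
  have hall : ∀ π : Equiv.Perm (Fin 3), ∑ i, M i (π i) ≠ 0 := by
    intro π
    have h01 : π 0 ≠ π 1 := π.injective.ne (by decide)
    have h02 : π 0 ≠ π 2 := π.injective.ne (by decide)
    have h12 : π 1 ≠ π 2 := π.injective.ne (by decide)
    have i01 := hinj 0 1 (by decide)
    have i02 := hinj 0 2 (by decide)
    have i12 := hinj 1 2 (by decide)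
    rw [Fin.sum_univ_three]
    generalize π 0 = a at *
    generalize π 1 = b at *
    generalize π 2 = c at *
    rw [hrow] at i01 i02 ⊢
    fin_cases a <;> fin_cases b <;> fin_cases c <;> simp [hcol, hneg] at * <;> grind
  rw [gMn, gM, Finset.filter_true_of_mem fun π _ => hall π, Finset.card_univ, Fintype.card_perm]
  rfl

/-- Theorem 1, equality case: for n ≥ 8 or n = 3 and a special n×n
matrix M, g_M(n) = 2(n−1)! if and only if M ∈ M₁(n) or M ∈ M₂(n). -/
theorem statement11 (n : ℕ) [NeZero n] (hn : 8 ≤ n ∨ n = 3)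
    (M : Matrix (Fin n) (Fin n) ℝ) (hM : IsSpecial n M) :
    gMn n M = 2 * Nat.factorial (n - 1) ↔ MemM1 n M ∨ MemM2 n M := by
  refine ⟨fun hg => ?_, fun h => h.elim gMn_of_memM1 gMn_of_memM2⟩
  by_cases hτ : ∃ τ, ∀ a b, a ≠ τ → b ≠ τ → M a = M b
  · obtain ⟨τ, hτ⟩ := hτ
    exact memM1_or_memM2_of_gMn_eq (by omega) hM hτ hg
  · push Not at hτ
    exfalso
    rcases hn with hn | rfl
    · have hcard : 4 ≤ Fintype.card (Fin n) := by rw [Fintype.card_fin]; omega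
      obtain ⟨i, k, i', k', h1, h2, h3, h4, hik, hik'⟩ := exists_disjoint_ne hcard M hτ
      obtain ⟨-, hcol, -, hsum⟩ := hM
      have hdiff : ∀ a b, M a ≠ M b → ∃ p q p' q', p ≠ p' ∧ p ≠ q' ∧ q ≠ p' ∧ q ≠ q' ∧
          M a p - M b p ≠ M a q - M b q ∧ M a p' - M b p' ≠ M a q' - M b q' := fun a b hab =>
        exists_disjoint_ne hcard (fun j => M a j - M b j)
          (exists_ne_off_of_sum_eq_zero (by simp [hcol]) (by simp [Finset.sum_sub_distrib, hsum])
            (sub_ne_zero.2 hab))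
      have hnodup : [i, k, i', k'].Nodup := by
        have : i ≠ k := fun h => hik (h ▸ rfl)
        have : i' ≠ k' := fun h => hik' (h ▸ rfl)
        simp
        tauto
      exact (two_mul_factorial_lt_gMn hn M hnodup (hdiff i k hik) (hdiff i' k' hik')).ne' hg
    · have h6 : gMn 3 M = 6 := by
        convert gMn_three_eq_six (M := M) hM hτ
      rw [h6] at hg
      exact absurd hg (by decide)
end
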